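/- arXiv:1907.06448 — 2 statements merged into one kernel-verified Lean document; each statement's English description precedes it below -/
import Mathlib

section
/- Let Λ be an almost n-minimal Auslander-Gorenstein algebra with n ≥ 2, i.e., an Artin algebra such that, for the injective module I with add I = {finitely generated injective Λ-modules of projective dimension at most 1}, one has id Λ ≤ n+1 ≤ I-domdim Λ. Let A = End_Λ(I) and let M = I viewed as a left A-module. Then for every finitely generated A-module X: if Ext^i_A(M,X) = 0 for all 1 ≤ i ≤ n−1, then Ext^i_A(X,M) = 0 for all 1 ≤ i ≤ n−1 (i.e., M^{⊥_{n−1}} ⊆ ^{⊥_{n−1}}M). -/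
open CategoryTheory

universe u

noncomputable instance hasExtModuleCat (A : Type u) [Ring A] : HasExt.{u+1} (ModuleCat.{u} A) :=
  letI := HasDerivedCategory.standard (ModuleCat.{u} A)
  hasExt_of_hasDerivedCategory _

/-- `Ext^i_A(X, Y) = 0`. -/
def ExtVanishes (A : Type u) [Ring A] (X Y : Type u) [AddCommGroup X] [Module A X]
    [AddCommGroup Y] [Module A Y] (i : ℕ) : Prop :=
  Subsingleton (Abelian.Ext (ModuleCat.of A X) (ModuleCat.of A Y) i)

/-- `X ∈ add M`: `X` is a direct summand of a finite direct sum of copies of `M`. -/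
def InAdd (Λ : Type u) [Ring Λ] (M : Type u) [AddCommGroup M] [Module Λ M]
    (X : Type u) [AddCommGroup X] [Module Λ X] : Prop :=
  ∃ (k : ℕ) (ι : X →ₗ[Λ] (Fin k → M)) (π : (Fin k → M) →ₗ[Λ] X), π ∘ₗ ι = LinearMap.id

/-- `I`-domdim of `Y` is at least `t`: there is an exact sequence
`0 → Y → J_0 → ⋯ → J_{t-1}` with all `J_i ∈ add I`. -/
def IDomdimGE (Λ : Type u) [Ring Λ] (I : Type u) [AddCommGroup I] [Module Λ I]
    (Y : Type u) [AddCommGroup Y] [Module Λ Y] (t : ℕ) : Prop :=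
  ∃ (J : ℕ → ModuleCat.{u} Λ) (g : Y →ₗ[Λ] J 0) (f : ∀ i, (J i : Type u) →ₗ[Λ] J (i+1)),
    (∀ i < t, InAdd Λ I (J i)) ∧
    (1 ≤ t → Function.Injective g) ∧
    (2 ≤ t → Function.Exact g (f 0)) ∧
    (∀ i, i + 3 ≤ t → Function.Exact (f i) (f (i+1)))

/-- The projective dimension of `N` is at most `m`: there is a projective resolution
`0 → P_m → ⋯ → P_0 → N → 0`. -/
def ProjDimLE (Λ : Type u) [Ring Λ] (N : Type u) [AddCommGroup N] [Module Λ N] (m : ℕ) : Prop :=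
  ∃ (P : ℕ → ModuleCat.{u} Λ) (f : ∀ i, (P (i+1) : Type u) →ₗ[Λ] P i) (g : (P 0 : Type u) →ₗ[Λ] N),
    (∀ i, Module.Projective Λ (P i)) ∧
    (∀ i, m < i → Subsingleton (P i)) ∧
    Function.Surjective g ∧ Function.Exact (f 0) g ∧
    (∀ i, Function.Exact (f (i+1)) (f i))

/-- The injective dimension of `N` is at most `m`: there is an injective coresolution
`0 → N → J_0 → ⋯ → J_m → 0`. -/
def InjDimLE (Λ : Type u) [Ring Λ] (N : Type u) [AddCommGroup N] [Module Λ N] (m : ℕ) : Prop :=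
  ∃ (J : ℕ → ModuleCat.{u} Λ) (g : N →ₗ[Λ] J 0) (f : ∀ i, (J i : Type u) →ₗ[Λ] J (i+1)),
    (∀ i, Module.Injective Λ (J i)) ∧
    (∀ i, m < i → Subsingleton (J i)) ∧
    Function.Injective g ∧ Function.Exact g (f 0) ∧
    (∀ i, Function.Exact (f i) (f (i+1)))

/-- `M` is a cogenerator: every finitely generated module embeds into a finite
direct sum of copies of `M`. -/
def IsCogenerator (A : Type u) [Ring A] (M : Type u) [AddCommGroup M] [Module A M] : Prop :=
  ∀ (X : Type u) [AddCommGroup X] [Module A X], Module.Finite A X →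
    ∃ (k : ℕ) (f : X →ₗ[A] (Fin k → M)), Function.Injective f

/-- `M`-codim `A ≤ m`: there is an exact sequence `0 → A → M_0 → ⋯ → M_m → 0` with all
`M_i ∈ add M` which stays exact after applying `Hom_A(-, M)`. -/
def MCodimLE (A : Type u) [Ring A] (M : Type u) [AddCommGroup M] [Module A M] (m : ℕ) : Prop :=
  ∃ (C : ℕ → ModuleCat.{u} A) (g : A →ₗ[A] C 0) (f : ∀ i, (C i : Type u) →ₗ[A] C (i+1)),
    (∀ i ≤ m, InAdd A M (C i)) ∧
    (∀ i, m < i → Subsingleton (C i)) ∧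
    Function.Injective g ∧ Function.Exact g (f 0) ∧
    (∀ i, Function.Exact (f i) (f (i+1))) ∧
    Function.Surjective (fun φ : (C 0 : Type u) →ₗ[A] M => φ ∘ₗ g) ∧
    Function.Exact (fun φ : (C 1 : Type u) →ₗ[A] M => φ ∘ₗ (f 0))
      (fun φ : (C 0 : Type u) →ₗ[A] M => φ ∘ₗ g) ∧
    (∀ i, Function.Exact (fun φ : (C (i+2) : Type u) →ₗ[A] M => φ ∘ₗ (f (i+1)))
      (fun φ : (C (i+1) : Type u) →ₗ[A] M => φ ∘ₗ (f i)))

/-- The canonical ring homomorphism from `Λ` to the endomorphism ring of `I` over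
`End_Λ(I)`, sending `λ` to multiplication by `λ`. -/
@[simps] def evalRingHom (Λ : Type u) [Ring Λ] (I : Type u) [AddCommGroup I] [Module Λ I] :
    Λ →+* Module.End (Module.End Λ I) I where
  toFun a :=
    { toFun := fun x => a • x
      map_add' := fun x y => smul_add a x y
      map_smul' := fun φ x => (φ.map_smul a x).symm }
  map_one' := by ext x; simp
  map_mul' a b := by ext x; simp [mul_smul]
  map_zero' := by ext x; simp
  map_add' a b := by ext x; simp [add_smul]

section ShortExact

variable {A : Type u} [Ring A]
  {X Y Z : Type u} [AddCommGroup X] [Module A X] [AddCommGroup Y] [Module A Y]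
  [AddCommGroup Z] [Module A Z]

/-- The sequence `0 → X → Y → Z → 0` given by `f` and `g` is short exact. -/
structure IsShortExact (f : X →ₗ[A] Y) (g : Y →ₗ[A] Z) : Prop where
  injective : Function.Injective f
  exact : Function.Exact f g
  surjective : Function.Surjective g

theorem isShortExact_mkQ {f : X →ₗ[A] Y} (hf : Function.Injective f) :
    IsShortExact f (LinearMap.range f).mkQ :=
  ⟨hf, LinearMap.exact_iff.2 (Submodule.ker_mkQ _), Submodule.mkQ_surjective _⟩

theorem isShortExact_subtype {g : Y →ₗ[A] Z} (hg : Function.Surjective g) :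
    IsShortExact (LinearMap.ker g).subtype g :=
  ⟨Submodule.injective_subtype _, LinearMap.exact_iff.2 (Submodule.range_subtype _).symm, hg⟩

theorem isShortExact_inl_snd : IsShortExact (LinearMap.inl A X Y) (LinearMap.snd A X Y) :=
  ⟨LinearMap.inl_injective, .inl_snd, LinearMap.snd_surjective⟩

namespace IsShortExact

variable {f : X →ₗ[A] Y} {g : Y →ₗ[A] Z} (h : IsShortExact f g)
include h

theorem comp_eq_zero : g ∘ₗ f = 0 := h.exact.linearMap_comp_eq_zero

theorem shortExact : (ShortComplex.mk (ModuleCat.ofHom f) (ModuleCat.ofHom g)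
    (by rw [← ModuleCat.ofHom_comp, h.comp_eq_zero]; rfl)).ShortExact :=
  ModuleCat.shortComplex_shortExact _ h.exact h.injective h.surjective

variable (N : Type u) [AddCommGroup N] [Module A N]

theorem extVanishes_right₂ {i : ℕ} (h₁ : ExtVanishes A N X i) (h₃ : ExtVanishes A N Z i) :
    ExtVanishes A N Y i := by
  refine subsingleton_of_forall_eq 0 fun x => ?_
  obtain ⟨y, rfl⟩ := Abelian.Ext.covariant_sequence_exact₂ _ h.shortExact x
    (h₃.elim _ _)
  rw [h₁.elim y 0, Abelian.Ext.zero_comp]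

theorem extVanishes_right₃ {i : ℕ} (h₂ : ExtVanishes A N Y i) (h₁ : ExtVanishes A N X (i + 1)) :
    ExtVanishes A N Z i := by
  refine subsingleton_of_forall_eq 0 fun x => ?_
  obtain ⟨y, rfl⟩ := Abelian.Ext.covariant_sequence_exact₃ _ h.shortExact x rfl
    (h₁.elim _ _)
  rw [h₂.elim y 0, Abelian.Ext.zero_comp]

theorem extVanishes_right₁ {i : ℕ} (h₃ : ExtVanishes A N Z i) (h₂ : ExtVanishes A N Y (i + 1)) :
    ExtVanishes A N X (i + 1) := by
  refine subsingleton_of_forall_eq 0 fun x => ?_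
  obtain ⟨y, rfl⟩ := Abelian.Ext.covariant_sequence_exact₁ _ h.shortExact x
    (h₂.elim _ _) rfl
  rw [h₃.elim y 0, Abelian.Ext.zero_comp]

theorem extVanishes_left₂ {i : ℕ} (h₁ : ExtVanishes A X N i) (h₃ : ExtVanishes A Z N i) :
    ExtVanishes A Y N i := by
  refine subsingleton_of_forall_eq 0 fun x => ?_
  obtain ⟨y, rfl⟩ := Abelian.Ext.contravariant_sequence_exact₂ h.shortExact _ x
    (h₁.elim _ _)
  rw [h₃.elim y 0, Abelian.Ext.comp_zero]

theorem extVanishes_left₁ {i : ℕ} (h₂ : ExtVanishes A Y N i) (h₃ : ExtVanishes A Z N (i + 1)) :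
    ExtVanishes A X N i := by
  refine subsingleton_of_forall_eq 0 fun x => ?_
  obtain ⟨y, rfl⟩ := Abelian.Ext.contravariant_sequence_exact₁ h.shortExact _ x (add_comm 1 i)
    (h₃.elim _ _)
  rw [h₂.elim y 0, Abelian.Ext.comp_zero]

theorem extVanishes_left₃ {i : ℕ} (h₁ : ExtVanishes A X N i) (h₂ : ExtVanishes A Y N (i + 1)) :
    ExtVanishes A Z N (i + 1) := by
  refine subsingleton_of_forall_eq 0 fun x => ?_
  obtain ⟨y, rfl⟩ := Abelian.Ext.contravariant_sequence_exact₃ h.shortExact _ x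
    (h₂.elim _ _) (add_comm 1 i)
  rw [h₁.elim y 0, Abelian.Ext.comp_zero]

variable {N}

theorem exists_lift (h₁ : ExtVanishes A N X 1) (φ : N →ₗ[A] Z) : ∃ ψ : N →ₗ[A] Y, g ∘ₗ ψ = φ := by
  obtain ⟨y, hy⟩ := Abelian.Ext.covariant_sequence_exact₃ (ModuleCat.of A N) h.shortExact
    (Abelian.Ext.mk₀ (ModuleCat.ofHom φ)) rfl (h₁.elim _ _)
  obtain ⟨y, rfl⟩ := (Abelian.Ext.mk₀_bijective _ _).2 y
  rw [Abelian.Ext.mk₀_comp_mk₀] at hy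
  exact ⟨y.hom, congrArg ModuleCat.Hom.hom ((Abelian.Ext.mk₀_bijective _ _).1 hy)⟩

theorem extVanishes_one_right (h₂ : ExtVanishes A N Y 1)
    (hl : ∀ φ : N →ₗ[A] Z, ∃ ψ : N →ₗ[A] Y, g ∘ₗ ψ = φ) : ExtVanishes A N X 1 := by
  refine subsingleton_of_forall_eq 0 fun x => ?_
  obtain ⟨y, rfl⟩ := Abelian.Ext.covariant_sequence_exact₁ _ h.shortExact x
    (h₂.elim _ _) (zero_add 1)
  obtain ⟨y, rfl⟩ := (Abelian.Ext.mk₀_bijective _ _).2 y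
  obtain ⟨ψ, hψ⟩ := hl y.hom
  have : y = ModuleCat.ofHom ψ ≫ ModuleCat.ofHom g := by ext1; exact hψ.symm
  rw [this, ← Abelian.Ext.mk₀_comp_mk₀, Abelian.Ext.comp_assoc_of_second_deg_zero,
    h.shortExact.comp_extClass, Abelian.Ext.comp_zero]

theorem exists_extend (h₃ : ExtVanishes A Z N 1) (φ : X →ₗ[A] N) :
    ∃ ψ : Y →ₗ[A] N, ψ ∘ₗ f = φ := by
  obtain ⟨y, hy⟩ := Abelian.Ext.contravariant_sequence_exact₁ h.shortExact (ModuleCat.of A N)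
    (Abelian.Ext.mk₀ (ModuleCat.ofHom φ)) rfl (h₃.elim _ _)
  obtain ⟨y, rfl⟩ := (Abelian.Ext.mk₀_bijective _ _).2 y
  rw [Abelian.Ext.mk₀_comp_mk₀] at hy
  exact ⟨y.hom, congrArg ModuleCat.Hom.hom ((Abelian.Ext.mk₀_bijective _ _).1 hy)⟩

theorem extVanishes_one_left (h₂ : ExtVanishes A Y N 1)
    (hl : ∀ φ : X →ₗ[A] N, ∃ ψ : Y →ₗ[A] N, ψ ∘ₗ f = φ) : ExtVanishes A Z N 1 := by
  refine subsingleton_of_forall_eq 0 fun x => ?_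
  obtain ⟨y, rfl⟩ := Abelian.Ext.contravariant_sequence_exact₃ h.shortExact _ x
    (h₂.elim _ _) (add_zero 1)
  obtain ⟨y, rfl⟩ := (Abelian.Ext.mk₀_bijective _ _).2 y
  obtain ⟨ψ, hψ⟩ := hl y.hom
  have : y = ModuleCat.ofHom f ≫ ModuleCat.ofHom ψ := by ext1; exact hψ.symm
  rw [this, ← Abelian.Ext.mk₀_comp_mk₀, ← Abelian.Ext.comp_assoc_of_second_deg_zero,
    h.shortExact.extClass_comp, Abelian.Ext.zero_comp]

end IsShortExact

theorem ExtVanishes.retract_right {N : Type u} [AddCommGroup N] [Module A N] {i : ℕ}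
    (h : ExtVanishes A N Y i) (ι : X →ₗ[A] Y) (π : Y →ₗ[A] X) (hπ : π ∘ₗ ι = LinearMap.id) :
    ExtVanishes A N X i := by
  refine subsingleton_of_forall_eq 0 fun x => ?_
  have e : ModuleCat.ofHom ι ≫ ModuleCat.ofHom π = 𝟙 (ModuleCat.of A X) := by
    ext1; exact hπ
  rw [← Abelian.Ext.comp_mk₀_id x, ← e, ← Abelian.Ext.mk₀_comp_mk₀,
    ← Abelian.Ext.comp_assoc_of_second_deg_zero,
    h.elim (x.comp (Abelian.Ext.mk₀ (ModuleCat.ofHom ι)) (add_zero i)) 0, Abelian.Ext.zero_comp]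

theorem ExtVanishes.retract_left {N : Type u} [AddCommGroup N] [Module A N] {i : ℕ}
    (h : ExtVanishes A Y N i) (ι : X →ₗ[A] Y) (π : Y →ₗ[A] X) (hπ : π ∘ₗ ι = LinearMap.id) :
    ExtVanishes A X N i := by
  refine subsingleton_of_forall_eq 0 fun x => ?_
  have e : ModuleCat.ofHom ι ≫ ModuleCat.ofHom π = 𝟙 (ModuleCat.of A X) := by
    ext1; exact hπ
  rw [← Abelian.Ext.mk₀_id_comp x, ← e, ← Abelian.Ext.mk₀_comp_mk₀,
    Abelian.Ext.comp_assoc_of_second_deg_zero,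
    h.elim ((Abelian.Ext.mk₀ (ModuleCat.ofHom π)).comp x (zero_add i)) 0, Abelian.Ext.comp_zero]

theorem ExtVanishes.congr_right {N : Type u} [AddCommGroup N] [Module A N] {i : ℕ}
    (h : ExtVanishes A N Y i) (e : X ≃ₗ[A] Y) : ExtVanishes A N X i :=
  h.retract_right e.toLinearMap e.symm.toLinearMap (by ext; simp)

theorem ExtVanishes.congr_left {N : Type u} [AddCommGroup N] [Module A N] {i : ℕ}
    (h : ExtVanishes A Y N i) (e : X ≃ₗ[A] Y) : ExtVanishes A X N i :=
  h.retract_left e.toLinearMap e.symm.toLinearMap (by ext; simp)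

theorem extVanishes_of_projective [Module.Projective A X] {i : ℕ} (hi : 1 ≤ i) :
    ExtVanishes A X Y i := by
  obtain ⟨i, rfl⟩ := Nat.exists_eq_add_of_le' hi
  have : Projective (ModuleCat.of A X) := (IsProjective.iff_projective X).1 ‹_›
  exact subsingleton_of_forall_eq 0 fun x => Abelian.Ext.eq_zero_of_projective x

theorem extVanishes_of_injective (hY : Module.Injective A Y) {i : ℕ} (hi : 1 ≤ i) :
    ExtVanishes A X Y i := by
  obtain ⟨i, rfl⟩ := Nat.exists_eq_add_of_le' hi
  have : Injective (ModuleCat.of A Y) := (Module.injective_iff_injective_object _ _).1 ‹_›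
  exact subsingleton_of_forall_eq 0 fun x => Abelian.Ext.eq_zero_of_injective x

end ShortExact

section Diagrams

variable {A : Type u} [Ring A]
  {X Y Z N : Type u} [AddCommGroup X] [Module A X] [AddCommGroup Y] [Module A Y]
  [AddCommGroup Z] [Module A Z] [AddCommGroup N] [Module A N]

namespace IsShortExact

theorem exists_desc {f : X →ₗ[A] Y} {g : Y →ₗ[A] Z} (h : IsShortExact f g) (φ : Y →ₗ[A] N)
    (hφ : φ ∘ₗ f = 0) : ∃ ψ : Z →ₗ[A] N, ψ ∘ₗ g = φ := by
  have hk : LinearMap.ker g ≤ LinearMap.ker φ := by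
    rw [LinearMap.exact_iff.1 h.exact]
    rintro _ ⟨x, rfl⟩
    exact LinearMap.congr_fun hφ x
  refine ⟨(LinearMap.ker g).liftQ φ hk ∘ₗ (g.quotKerEquivOfSurjective h.surjective).symm, ?_⟩
  ext y
  have : (g.quotKerEquivOfSurjective h.surjective).symm (g y) = (LinearMap.ker g).mkQ y := by
    rw [LinearEquiv.symm_apply_eq]
    simp
  simp [this]

theorem exists_factor {f : X →ₗ[A] Y} {g : Y →ₗ[A] Z} (h : IsShortExact f g) (φ : N →ₗ[A] Y)
    (hφ : g ∘ₗ φ = 0) : ∃ ψ : N →ₗ[A] X, f ∘ₗ ψ = φ := by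
  have hr : ∀ x, φ x ∈ LinearMap.range f := fun x =>
    (h.exact (φ x)).1 (LinearMap.congr_fun hφ x)
  refine ⟨(LinearEquiv.ofInjective f h.injective).symm ∘ₗ φ.codRestrict _ hr, ?_⟩
  ext x
  have := (LinearEquiv.ofInjective f h.injective).apply_symm_apply ⟨φ x, hr x⟩
  exact congrArg Subtype.val this

theorem apply_apply {f : X →ₗ[A] Y} {g : Y →ₗ[A] Z} (h : IsShortExact f g) (x : X) :
    g (f x) = 0 := h.exact.apply_apply_eq_zero x

theorem finite_right {f : X →ₗ[A] Y} {g : Y →ₗ[A] Z} (h : IsShortExact f g)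
    [Module.Finite A Y] : Module.Finite A Z :=
  Module.Finite.of_surjective g h.surjective

theorem finite_left [IsNoetherianRing A] {f : X →ₗ[A] Y} {g : Y →ₗ[A] Z} (h : IsShortExact f g)
    [Module.Finite A Y] : Module.Finite A X :=
  Module.Finite.of_injective f h.injective

section Grid

variable {X' Y' Z' X'' Y'' Z'' : Type u} [AddCommGroup X'] [Module A X'] [AddCommGroup Y']
  [Module A Y'] [AddCommGroup Z'] [Module A Z'] [AddCommGroup X''] [Module A X'']
  [AddCommGroup Y''] [Module A Y''] [AddCommGroup Z''] [Module A Z'']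
  {f : X →ₗ[A] Y} {g : Y →ₗ[A] Z} {f' : X' →ₗ[A] Y'} {g' : Y' →ₗ[A] Z'}
  {iX : X →ₗ[A] X'} {iY : Y →ₗ[A] Y'} {iZ : Z →ₗ[A] Z'}
  {pX : X' →ₗ[A] X''} {pY : Y' →ₗ[A] Y''} {pZ : Z' →ₗ[A] Z''}

/-- The cokernel row of a morphism of short exact sequences with injective outer columns. -/
theorem exists_cokernel_row (h : IsShortExact f g) (h' : IsShortExact f' g')
    (hX : IsShortExact iX pX) (hY : IsShortExact iY pY) (hZ : IsShortExact iZ pZ)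
    (hf : iY ∘ₗ f = f' ∘ₗ iX) (hg : iZ ∘ₗ g = g' ∘ₗ iY) :
    ∃ (f'' : X'' →ₗ[A] Y'') (g'' : Y'' →ₗ[A] Z''), IsShortExact f'' g'' := by
  obtain ⟨f'', hf''⟩ := hX.exists_desc (pY ∘ₗ f') (by
    rw [LinearMap.comp_assoc, ← hf, ← LinearMap.comp_assoc, hY.comp_eq_zero, LinearMap.zero_comp])
  obtain ⟨g'', hg''⟩ := hY.exists_desc (pZ ∘ₗ g') (by
    rw [LinearMap.comp_assoc, ← hg, ← LinearMap.comp_assoc, hZ.comp_eq_zero, LinearMap.zero_comp])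
  replace hf := LinearMap.congr_fun hf
  replace hg := LinearMap.congr_fun hg
  replace hf'' := LinearMap.congr_fun hf''
  replace hg'' := LinearMap.congr_fun hg''
  simp only [LinearMap.comp_apply] at hf hg hf'' hg''
  refine ⟨f'', g'', ?_, ?_, ?_⟩
  · rw [injective_iff_map_eq_zero]
    intro x hx
    obtain ⟨x, rfl⟩ := hX.surjective x
    rw [hf'', hY.exact] at hx
    obtain ⟨y, hy⟩ := hx
    have hz : g y = 0 := hZ.injective (by rw [hg, hy, h'.apply_apply, map_zero])
    obtain ⟨w, rfl⟩ := (h.exact y).1 hz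
    rw [hf] at hy
    rw [← h'.injective hy, hX.apply_apply]
  · intro y
    constructor
    · intro hy
      obtain ⟨y, rfl⟩ := hY.surjective y
      rw [hg'', hZ.exact] at hy
      obtain ⟨z, hz⟩ := hy
      obtain ⟨w, rfl⟩ := h.surjective z
      have : g' (y - iY w) = 0 := by rw [map_sub, ← hz, hg, sub_self]
      obtain ⟨x, hx⟩ := (h'.exact _).1 this
      refine ⟨pX x, ?_⟩
      rw [hf'', hx, map_sub, hY.apply_apply, sub_zero]
    · rintro ⟨x, rfl⟩
      obtain ⟨x, rfl⟩ := hX.surjective x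
      rw [hf'', hg'', h'.apply_apply, map_zero]
  · intro z
    obtain ⟨z, rfl⟩ := hZ.surjective z
    obtain ⟨y, rfl⟩ := h'.surjective z
    exact ⟨pY y, hg'' y⟩

/-- The kernel row of a morphism of short exact sequences with surjective outer columns. -/
theorem exists_kernel_row (h' : IsShortExact f' g') {f'' : X'' →ₗ[A] Y''} {g'' : Y'' →ₗ[A] Z''}
    (h'' : IsShortExact f'' g'')
    (hX : IsShortExact iX pX) (hY : IsShortExact iY pY) (hZ : IsShortExact iZ pZ)
    (hf : f'' ∘ₗ pX = pY ∘ₗ f') (hg : g'' ∘ₗ pY = pZ ∘ₗ g') :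
    ∃ (f : X →ₗ[A] Y) (g : Y →ₗ[A] Z), IsShortExact f g := by
  obtain ⟨f, hf₀⟩ := hY.exists_factor (f' ∘ₗ iX) (by
    rw [← LinearMap.comp_assoc, ← hf, LinearMap.comp_assoc, hX.comp_eq_zero, LinearMap.comp_zero])
  obtain ⟨g, hg₀⟩ := hZ.exists_factor (g' ∘ₗ iY) (by
    rw [← LinearMap.comp_assoc, ← hg, LinearMap.comp_assoc, hY.comp_eq_zero, LinearMap.comp_zero])
  replace hf := LinearMap.congr_fun hf
  replace hg := LinearMap.congr_fun hg
  replace hf₀ := LinearMap.congr_fun hf₀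
  replace hg₀ := LinearMap.congr_fun hg₀
  simp only [LinearMap.comp_apply] at hf hg hf₀ hg₀
  refine ⟨f, g, ?_, ?_, ?_⟩
  · rw [injective_iff_map_eq_zero]
    intro x hx
    have := hf₀ x
    rw [hx, map_zero] at this
    exact hX.injective (h'.injective (by rw [← this, map_zero, map_zero]))
  · intro y
    constructor
    · intro hy
      have hy' := hg₀ y
      rw [hy, map_zero] at hy'
      obtain ⟨x, hx⟩ := (h'.exact _).1 hy'.symm
      have hx' : pX x = 0 := h''.injective (by rw [hf, hx, hY.apply_apply, map_zero])
      obtain ⟨w, rfl⟩ := (hX.exact _).1 hx'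
      exact ⟨w, hY.injective (by rw [hf₀, hx])⟩
    · rintro ⟨x, rfl⟩
      exact hZ.injective (by rw [hg₀, hf₀, h'.apply_apply, map_zero])
  · intro z
    obtain ⟨y, hy⟩ := h'.surjective (iZ z)
    have : g'' (pY y) = 0 := by rw [hg, hy, hZ.apply_apply]
    obtain ⟨x, hx⟩ := (h''.exact _).1 this
    obtain ⟨x, rfl⟩ := hX.surjective x
    rw [hf] at hx
    have h0 : pY (y - f' x) = 0 := by rw [map_sub, hx, sub_self]
    obtain ⟨w, hw⟩ := (hY.exact _).1 h0
    exact ⟨w, hZ.injective (by rw [hg₀, hw, map_sub, h'.apply_apply, sub_zero, hy])⟩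

end Grid

/-- For `Y ⊆ P ⊆ W`, the quotient `W / Y` is an extension of `W / P` by `P / Y`. -/
theorem exists_comp {P W C D : Type u} [AddCommGroup P] [Module A P] [AddCommGroup W] [Module A W]
    [AddCommGroup C] [Module A C] [AddCommGroup D] [Module A D]
    {f : Y →ₗ[A] P} {g : P →ₗ[A] C} {i : P →ₗ[A] W} {p : W →ₗ[A] D}
    (h : IsShortExact f g) (h' : IsShortExact i p) :
    ∃ (E : Type u) (_ : AddCommGroup E) (_ : Module A E) (q : W →ₗ[A] E)
      (j : C →ₗ[A] E) (r : E →ₗ[A] D), IsShortExact (i ∘ₗ f) q ∧ IsShortExact j r := by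
  have hif : IsShortExact (i ∘ₗ f) (LinearMap.range (i ∘ₗ f)).mkQ :=
    isShortExact_mkQ (h'.injective.comp h.injective)
  generalize (LinearMap.range (i ∘ₗ f)).mkQ = q at hif
  refine ⟨_, inferInstance, inferInstance, q, ?_⟩
  obtain ⟨j, hj⟩ := h.exists_desc (q ∘ₗ i) hif.comp_eq_zero
  obtain ⟨r, hr⟩ := hif.exists_desc p (by
    rw [← LinearMap.comp_assoc, h'.comp_eq_zero, LinearMap.zero_comp])
  replace hj := LinearMap.congr_fun hj
  replace hr := LinearMap.congr_fun hr
  simp only [LinearMap.comp_apply] at hj hr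
  refine ⟨j, r, hif, ?_, ?_, ?_⟩
  · rw [injective_iff_map_eq_zero]
    intro c hc
    obtain ⟨x, rfl⟩ := h.surjective c
    rw [hj, hif.exact] at hc
    obtain ⟨y, hy⟩ := hc
    rw [← h'.injective hy, h.apply_apply]
  · intro e
    constructor
    · intro he
      obtain ⟨w, rfl⟩ := hif.surjective e
      rw [hr, h'.exact] at he
      obtain ⟨x, rfl⟩ := he
      exact ⟨g x, hj x⟩
    · rintro ⟨c, rfl⟩
      obtain ⟨x, rfl⟩ := h.surjective c
      rw [hj, hr, h'.apply_apply]
  · intro d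
    obtain ⟨w, rfl⟩ := h'.surjective d
    exact ⟨q w, hr w⟩

end IsShortExact

end Diagrams

section InAdd

variable {Λ : Type u} [Ring Λ] {M : Type u} [AddCommGroup M] [Module Λ M]

theorem InAdd.induction {P : ∀ (X : Type u) [AddCommGroup X] [Module Λ X], Prop}
    (base : P M) (zero : P PUnit.{u + 1})
    (prod : ∀ (X Y : Type u) [AddCommGroup X] [Module Λ X] [AddCommGroup Y] [Module Λ Y],
      P X → P Y → P (X × Y))
    (retract : ∀ (X Y : Type u) [AddCommGroup X] [Module Λ X] [AddCommGroup Y] [Module Λ Y]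
      (ι : X →ₗ[Λ] Y) (π : Y →ₗ[Λ] X), π ∘ₗ ι = LinearMap.id → P Y → P X)
    {X : Type u} [AddCommGroup X] [Module Λ X] (hX : InAdd Λ M X) : P X := by
  obtain ⟨k, ι, π, h⟩ := hX
  refine retract _ _ ι π h ?_
  clear h ι π
  induction k with
  | zero => exact retract _ PUnit.{u + 1} 0 0 (Subsingleton.elim _ _) zero
  | succ k ih =>
    let e := Fin.consLinearEquiv Λ (fun _ : Fin (k + 1) => M)
    exact retract _ (M × (Fin k → M)) e.symm.toLinearMap e.toLinearMap (by ext; simp)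
      (prod _ _ base ih)

theorem InAdd.retract {X Y : Type u} [AddCommGroup X] [Module Λ X] [AddCommGroup Y] [Module Λ Y]
    (hY : InAdd Λ M Y) (ι : X →ₗ[Λ] Y) (π : Y →ₗ[Λ] X) (h : π ∘ₗ ι = LinearMap.id) :
    InAdd Λ M X := by
  obtain ⟨k, ι', π', h'⟩ := hY
  refine ⟨k, ι' ∘ₗ ι, π ∘ₗ π', ?_⟩
  rw [LinearMap.comp_assoc, ← LinearMap.comp_assoc ι, h', LinearMap.id_comp, h]

theorem InAdd.congr {X Y : Type u} [AddCommGroup X] [Module Λ X] [AddCommGroup Y] [Module Λ Y]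
    (hY : InAdd Λ M Y) (e : X ≃ₗ[Λ] Y) : InAdd Λ M X :=
  hY.retract e.toLinearMap e.symm.toLinearMap (by ext; simp)

theorem inAdd_pi (k : ℕ) : InAdd Λ M (Fin k → M) := ⟨k, .id, .id, rfl⟩

theorem inAdd_self : InAdd Λ M M :=
  (inAdd_pi 1).congr (LinearEquiv.funUnique (Fin 1) Λ M).symm

theorem inAdd_punit : InAdd Λ M PUnit.{u + 1} := ⟨0, 0, 0, Subsingleton.elim _ _⟩

theorem InAdd.prod {X Y : Type u} [AddCommGroup X] [Module Λ X] [AddCommGroup Y] [Module Λ Y]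
    (hX : InAdd Λ M X) (hY : InAdd Λ M Y) : InAdd Λ M (X × Y) := by
  obtain ⟨k, ι, π, h⟩ := hX
  obtain ⟨l, ι', π', h'⟩ := hY
  refine ((inAdd_pi (k + l)).congr ((LinearEquiv.sumArrowLequivProdArrow (Fin k) (Fin l) Λ M).symm
    ≪≫ₗ LinearEquiv.funCongrLeft Λ M finSumFinEquiv.symm)).retract (ι.prodMap ι') (π.prodMap π') ?_
  rw [LinearMap.prodMap_comp, h, h', LinearMap.prodMap_id]

theorem InAdd.trans {M' X : Type u} [AddCommGroup M'] [Module Λ M'] [AddCommGroup X] [Module Λ X]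
    (hM : InAdd Λ M' M) (hX : InAdd Λ M X) : InAdd Λ M' X :=
  hX.induction hM inAdd_punit (fun _ _ => .prod) (fun _ _ _ _ _ _ ι π h hY => hY.retract ι π h)

theorem InAdd.finite [Module.Finite Λ M] {X : Type u} [AddCommGroup X] [Module Λ X]
    (hX : InAdd Λ M X) : Module.Finite Λ X := by
  obtain ⟨k, ι, π, h⟩ := hX
  exact Module.Finite.of_surjective π fun x => ⟨ι x, LinearMap.congr_fun h x⟩

theorem InAdd.injective (hM : Module.Injective Λ M) {X : Type u} [AddCommGroup X] [Module Λ X]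
    (hX : InAdd Λ M X) : Module.Injective Λ X := by
  refine hX.induction (P := fun X _ _ => Module.Injective Λ X) hM
    ⟨fun _ _ _ _ _ _ _ _ _ => ⟨0, fun _ => Subsingleton.elim _ _⟩⟩ ?_ ?_
  · intro X Y _ _ _ _ hX hY
    refine ⟨fun U V _ _ _ _ f hf g => ?_⟩
    obtain ⟨a, ha⟩ := hX.out f hf (LinearMap.fst Λ X Y ∘ₗ g)
    obtain ⟨b, hb⟩ := hY.out f hf (LinearMap.snd Λ X Y ∘ₗ g)
    exact ⟨a.prod b, fun x => Prod.ext (ha x) (hb x)⟩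
  · intro X Y _ _ _ _ ι π h hY
    refine ⟨fun U V _ _ _ _ f hf g => ?_⟩
    obtain ⟨a, ha⟩ := hY.out f hf (ι ∘ₗ g)
    refine ⟨π ∘ₗ a, fun x => ?_⟩
    simp only [LinearMap.comp_apply, ha]
    exact LinearMap.congr_fun h (g x)

end InAdd

section Domdim

variable {Λ : Type u} [Ring Λ]

/-- The inductive form of `IDomdimGE`: there is an exact sequence `0 → Z → W_0 → ⋯ → W_{t-1}`
with all `W_i ∈ add I`. -/
def DomdimGE (Λ : Type u) [Ring Λ] (I : Type u) [AddCommGroup I] [Module Λ I] :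
    ℕ → ∀ (Z : Type u) [AddCommGroup Z] [Module Λ Z], Prop
  | 0, _, _, _ => True
  | t + 1, Z, _, _ => ∃ (W C : Type u) (_ : AddCommGroup W) (_ : Module Λ W) (_ : AddCommGroup C)
      (_ : Module Λ C) (f : Z →ₗ[Λ] W) (g : W →ₗ[Λ] C), InAdd Λ I W ∧ IsShortExact f g ∧
      DomdimGE Λ I t C

variable {I : Type u} [AddCommGroup I] [Module Λ I]

theorem DomdimGE.mono {t s : ℕ} (hts : t ≤ s) {Z : Type u} [AddCommGroup Z] [Module Λ Z]
    (h : DomdimGE Λ I s Z) : DomdimGE Λ I t Z := by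
  induction s generalizing t Z with
  | zero => obtain rfl : t = 0 := by omega
            trivial
  | succ s ih =>
    cases t with
    | zero => trivial
    | succ t =>
      obtain ⟨W, C, _, _, _, _, f, g, hW, hfg, hC⟩ := h
      exact ⟨W, C, _, _, _, _, f, g, hW, hfg, ih (by omega) hC⟩

theorem InAdd.domdimGE {Z : Type u} [AddCommGroup Z] [Module Λ Z] (h : InAdd Λ I Z) (t : ℕ) :
    DomdimGE Λ I t Z := by
  induction t generalizing Z with
  | zero => trivial
  | succ t ih =>
    exact ⟨Z, _, _, _, _, _, .id, _, h, isShortExact_mkQ Function.injective_id, ih <|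
      inAdd_punit.retract 0 0 <| by
        have : Subsingleton (Z ⧸ LinearMap.range (LinearMap.id : Z →ₗ[Λ] Z)) := by
          rw [Submodule.Quotient.subsingleton_iff, LinearMap.range_id]
        exact Subsingleton.elim _ _⟩

theorem DomdimGE.extension (hI : Module.Injective Λ I) {t : ℕ} {X Y Z : Type u}
    [AddCommGroup X] [Module Λ X] [AddCommGroup Y] [Module Λ Y] [AddCommGroup Z] [Module Λ Z]
    {f : X →ₗ[Λ] Y} {g : Y →ₗ[Λ] Z} (h : IsShortExact f g) (hX : DomdimGE Λ I t X)
    (hZ : DomdimGE Λ I t Z) : DomdimGE Λ I t Y := by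
  induction t generalizing X Y Z with
  | zero => trivial
  | succ t ih =>
    obtain ⟨W, C, _, _, _, _, i, p, hW, hip, hC⟩ := hX
    obtain ⟨W', C', _, _, _, _, i', p', hW', hip', hC'⟩ := hZ
    obtain ⟨e, he⟩ := (hW.injective hI).out f h.injective i
    have hinj : Function.Injective (e.prod (i' ∘ₗ g)) := by
      rw [injective_iff_map_eq_zero]
      intro y hy
      obtain ⟨hy₁, hy₂⟩ := Prod.ext_iff.1 hy
      obtain ⟨x, rfl⟩ := (h.exact y).1 (hip'.injective (hy₂.trans (map_zero i').symm))
      have : i x = i 0 := by rw [← he, map_zero]; exact hy₁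
      rw [hip.injective this, map_zero]
    obtain ⟨f'', g'', h''⟩ := h.exists_cokernel_row isShortExact_inl_snd hip
      (isShortExact_mkQ hinj) hip'
      (by ext x; exacts [he x, (congrArg i' (h.apply_apply x)).trans (map_zero i')])
      (LinearMap.ext fun _ => rfl)
    exact ⟨W × W', _, _, _, _, _, _, _, hW.prod hW', isShortExact_mkQ hinj, ih h'' hC hC'⟩

theorem DomdimGE.congr {t : ℕ} {X Y : Type u} [AddCommGroup X] [Module Λ X] [AddCommGroup Y]
    [Module Λ Y] (h : DomdimGE Λ I t Y) (e : X ≃ₗ[Λ] Y) : DomdimGE Λ I t X := by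
  cases t with
  | zero => trivial
  | succ t =>
    obtain ⟨W, C, _, _, _, _, f, g, hW, hfg, hC⟩ := h
    exact ⟨W, C, _, _, _, _, f ∘ₗ e.toLinearMap, g, hW, ⟨hfg.injective.comp e.injective,
      fun w => (hfg.exact w).trans (by simp [e.surjective.range_comp]), hfg.surjective⟩, hC⟩

theorem DomdimGE.pi (hI : Module.Injective Λ I) {t : ℕ} {X : Type u} [AddCommGroup X] [Module Λ X]
    (h : DomdimGE Λ I t X) (k : ℕ) : DomdimGE Λ I t (Fin k → X) := by
  induction k with
  | zero => exact (inAdd_pi (Λ := Λ) (M := I) 0 |>.congr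
      ((LinearEquiv.ofSubsingleton (Fin 0 → X) (Fin 0 → I)))).domdimGE t
  | succ k ih =>
    exact (DomdimGE.extension hI isShortExact_inl_snd h ih).congr
      (Fin.consLinearEquiv Λ (fun _ : Fin (k + 1) => X)).symm

/-- A submodule has large dominant dimension if the ambient module and the quotient do. -/
theorem DomdimGE.left (hI : Module.Injective Λ I) {t : ℕ} {X Y Z : Type u}
    [AddCommGroup X] [Module Λ X] [AddCommGroup Y] [Module Λ Y] [AddCommGroup Z] [Module Λ Z]
    {f : X →ₗ[Λ] Y} {g : Y →ₗ[Λ] Z} (h : IsShortExact f g) (hY : DomdimGE Λ I (t + 1) Y)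
    (hZ : DomdimGE Λ I t Z) : DomdimGE Λ I (t + 1) X := by
  obtain ⟨W, C, _, _, _, _, i, p, hW, hip, hC⟩ := hY
  obtain ⟨E, _, _, q, j, r, hq, hjr⟩ := h.exists_comp hip
  exact ⟨W, E, _, _, _, _, _, q, hW, hq, DomdimGE.extension hI hjr hZ hC⟩

end Domdim

section Bidual

variable {R S : Type u} [Ring R] [Ring S] {I : Type u} [AddCommGroup I] [Module R I] [Module S I]
  [SMulCommClass R S I] [SMulCommClass S R I]

/-- The evaluation map from `X` to its bidual with respect to the bimodule `I`. -/
@[simps] def biEval (R S : Type u) [Ring R] [Ring S] (I : Type u) [AddCommGroup I] [Module R I]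
    [Module S I] [SMulCommClass R S I] [SMulCommClass S R I] (X : Type u) [AddCommGroup X]
    [Module R X] : X →ₗ[R] ((X →ₗ[R] I) →ₗ[S] I) where
  toFun x :=
    { toFun := fun f => f x
      map_add' := fun _ _ => rfl
      map_smul' := fun _ _ => rfl }
  map_add' x y := by ext f; exact f.map_add x y
  map_smul' r x := by ext f; exact f.map_smul r x

variable {X Y : Type u} [AddCommGroup X] [Module R X] [AddCommGroup Y] [Module R Y]

theorem biEval_bijective_of_retract (ι : X →ₗ[R] Y) (π : Y →ₗ[R] X) (h : π ∘ₗ ι = LinearMap.id)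
    (hY : Function.Bijective (biEval R S I Y)) : Function.Bijective (biEval R S I X) := by
  replace h := LinearMap.congr_fun h
  simp only [LinearMap.comp_apply, LinearMap.id_apply] at h
  constructor
  · intro x x' hx
    have : ι x = ι x' := hY.1 <| by
      ext f
      exact LinearMap.congr_fun hx (f ∘ₗ ι)
    rw [← h x, this, h]
  · intro ψ
    obtain ⟨y, hy⟩ := hY.2 (ψ ∘ₗ LinearMap.lcomp S I ι)
    refine ⟨π y, ?_⟩
    ext f
    have : (f ∘ₗ π) ∘ₗ ι = f := by ext; simp [h]
    calc f (π y) = ψ ((f ∘ₗ π) ∘ₗ ι) := LinearMap.congr_fun hy (f ∘ₗ π)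
      _ = ψ f := by rw [this]

theorem biEval_bijective_prod (hX : Function.Bijective (biEval R S I X))
    (hY : Function.Bijective (biEval R S I Y)) : Function.Bijective (biEval R S I (X × Y)) := by
  constructor
  · intro p q h
    refine Prod.ext (hX.1 ?_) (hY.1 ?_) <;> ext f
    · exact LinearMap.congr_fun h (f ∘ₗ LinearMap.fst R X Y)
    · exact LinearMap.congr_fun h (f ∘ₗ LinearMap.snd R X Y)
  · intro ψ
    obtain ⟨x, hx⟩ := hX.2 (ψ ∘ₗ LinearMap.lcomp S I (LinearMap.fst R X Y))
    obtain ⟨y, hy⟩ := hY.2 (ψ ∘ₗ LinearMap.lcomp S I (LinearMap.snd R X Y))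
    refine ⟨(x, y), ?_⟩
    ext f
    have h₁ := LinearMap.congr_fun hx (f ∘ₗ LinearMap.inl R X Y)
    have h₂ := LinearMap.congr_fun hy (f ∘ₗ LinearMap.inr R X Y)
    simp only [biEval_apply_apply, LinearMap.comp_apply, LinearMap.lcomp_apply'] at h₁ h₂ ⊢
    have : f (x, y) = f (LinearMap.inl R X Y x) + f (LinearMap.inr R X Y y) := by
      rw [← map_add]
      simp
    rw [this, h₁, h₂, ← map_add]
    congr 1
    ext <;> simp [← Prod.zero_eq_mk]

theorem InAdd.biEval_bijective {M : Type u} [AddCommGroup M] [Module R M]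
    (hM : Function.Bijective (biEval R S I M)) (hX : InAdd R M X) :
    Function.Bijective (biEval R S I X) := by
  refine hX.induction (P := fun X _ _ => Function.Bijective (biEval R S I X)) hM ?_
    (fun _ _ _ _ _ _ => biEval_bijective_prod) (fun _ _ _ _ _ _ => biEval_bijective_of_retract)
  refine ⟨Function.injective_of_subsingleton _, fun ψ => ⟨0, ?_⟩⟩
  ext f
  rw [Subsingleton.elim f 0, map_zero, map_zero]

/-- If `0 → X → Y → Z` is exact and the evaluation maps of `Y`, `Z` are bijective, respectively
injective, then so is that of `X`, provided every map `X → I` extends to `Y`. -/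
theorem biEval_bijective_of_exact {Z : Type u} [AddCommGroup Z] [Module R Z] {f : X →ₗ[R] Y}
    {g : Y →ₗ[R] Z} (hf : Function.Injective f) (hfg : Function.Exact f g)
    (hext : ∀ φ : X →ₗ[R] I, ∃ ψ : Y →ₗ[R] I, ψ ∘ₗ f = φ)
    (hY : Function.Bijective (biEval R S I Y)) (hZ : Function.Injective (biEval R S I Z)) :
    Function.Bijective (biEval R S I X) := by
  constructor
  · intro x x' h
    refine hf (hY.1 ?_)
    ext φ
    exact LinearMap.congr_fun h (φ ∘ₗ f)
  · intro ψ
    obtain ⟨y, hy⟩ := hY.2 (ψ ∘ₗ LinearMap.lcomp S I f)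
    replace hy := LinearMap.congr_fun hy
    have : g y = 0 := hZ <| by
      ext φ
      rw [map_zero, LinearMap.zero_apply]
      refine (hy (φ ∘ₗ g)).trans ?_
      rw [LinearMap.comp_apply, LinearMap.lcomp_apply', LinearMap.comp_assoc,
        hfg.linearMap_comp_eq_zero, LinearMap.comp_zero, map_zero]
    obtain ⟨x, rfl⟩ := (hfg y).1 this
    refine ⟨x, ?_⟩
    ext φ
    obtain ⟨φ, rfl⟩ := hext φ
    exact hy φ

theorem exists_of_dual (hY : Function.Bijective (biEval R S I Y))
    (φ : (Y →ₗ[R] I) →ₗ[S] (X →ₗ[R] I)) : ∃ φ' : X →ₗ[R] Y, ∀ h x, h (φ' x) = φ h x := by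
  refine ⟨(LinearEquiv.ofBijective _ hY).symm ∘ₗ LinearMap.lcomp R I φ ∘ₗ biEval R S I X,
    fun h x => ?_⟩
  have := (LinearEquiv.ofBijective _ hY).apply_symm_apply (LinearMap.lcomp R I φ (biEval R S I X x))
  exact LinearMap.congr_fun this h

end Bidual

section Transfer

variable {Λ : Type u} [Ring Λ] {I : Type u} [AddCommGroup I] [Module Λ I]

/-- Every finitely generated module over a Noetherian ring `End_Λ(I)` is reflexive with respect to
an injective module `I`. -/
theorem biEval_end_bijective [IsNoetherianRing (Module.End Λ I)] (hI : Module.Injective Λ I)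
    (X : Type u) [AddCommGroup X] [Module (Module.End Λ I) X] [Module.Finite (Module.End Λ I) X] :
    Function.Bijective (biEval (Module.End Λ I) Λ I X) := by
  have hA : Function.Bijective (biEval (Module.End Λ I) Λ I (Module.End Λ I)) := by
    let e := LinearMap.ringLmapEquivSelf (Module.End Λ I) Λ I
    constructor
    · intro α β h
      ext x
      simpa [e] using LinearMap.congr_fun h (e.symm x)
    · intro ψ
      refine ⟨ψ ∘ₗ e.symm.toLinearMap, ?_⟩
      ext f
      obtain ⟨x, rfl⟩ := e.symm.surjective f
      simp [e]
  have hP (k : ℕ) := InAdd.biEval_bijective hA (inAdd_pi (M := Module.End Λ I) k)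
  obtain ⟨a, p, hp⟩ := Module.Finite.exists_fin' (Module.End Λ I) X
  obtain ⟨b, q, hq⟩ := Module.Finite.exists_fin' (Module.End Λ I) (LinearMap.ker p)
  have hpI : Function.Injective (LinearMap.lcomp Λ I p) := fun f g h =>
    LinearMap.ext fun x => by
      obtain ⟨y, rfl⟩ := hp x
      exact LinearMap.congr_fun h y
  constructor
  · rw [injective_iff_map_eq_zero]
    intro x hx
    obtain ⟨α, rfl⟩ := hp x
    let r := (LinearMap.ker p).subtype ∘ₗ q
    have hαr : ∀ f : (Fin a → Module.End Λ I) →ₗ[Module.End Λ I] I, f ∘ₗ r = 0 → f α = 0 := by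
      intro f hf
      obtain ⟨g, rfl⟩ := (isShortExact_subtype hp).exists_desc f (by
        ext y
        obtain ⟨y, rfl⟩ := hq y
        exact LinearMap.congr_fun hf y)
      exact LinearMap.congr_fun hx g
    obtain ⟨e, he⟩ := (isShortExact_subtype (LinearMap.surjective_rangeRestrict
      (LinearMap.lcomp Λ I r))).exists_desc (biEval (Module.End Λ I) Λ I _ α) (by
        ext ⟨f, hf⟩
        exact hαr f (congrArg Subtype.val hf))
    obtain ⟨γ, hγ⟩ := hI.out _ (Submodule.injective_subtype _) e
    obtain ⟨β, rfl⟩ := (hP b).2 γ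
    have : α = r β := (hP a).1 <| by
      ext f
      have := LinearMap.congr_fun he f
      rw [LinearMap.comp_apply, ← hγ] at this
      exact this.symm
    rw [this]
    exact (q β).2
  · intro ψ
    obtain ⟨χ, hχ⟩ := hI.out _ hpI ψ
    obtain ⟨α, rfl⟩ := (hP a).2 χ
    exact ⟨p α, LinearMap.ext hχ⟩

theorem InAdd.biEval_injective_bijective {W : Type u} [AddCommGroup W] [Module Λ W]
    (hW : InAdd Λ I W) : Function.Bijective (biEval Λ (Module.End Λ I) I W) := by
  refine InAdd.biEval_bijective ⟨fun x y h => LinearMap.congr_fun h LinearMap.id, fun ψ =>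
    ⟨ψ LinearMap.id, LinearMap.ext fun f => ?_⟩⟩ hW
  change f (ψ LinearMap.id) = ψ f
  exact (ψ.map_smul (f : Module.End Λ I) LinearMap.id).symm

theorem InAdd.projective_dual {W : Type u} [AddCommGroup W] [Module Λ W] (hW : InAdd Λ I W) :
    Module.Projective (Module.End Λ I) (W →ₗ[Λ] I) := by
  refine hW.induction (P := fun W _ _ => Module.Projective (Module.End Λ I) (W →ₗ[Λ] I)) ?_ ?_ ?_ ?_
  · exact inferInstanceAs (Module.Projective (Module.End Λ I) (Module.End Λ I))
  · have : Subsingleton (PUnit.{u + 1} →ₗ[Λ] I) := ⟨fun f g => by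
      ext x
      rw [Subsingleton.elim x 0, map_zero, map_zero]⟩
    infer_instance
  · intro X Y _ _ _ _ _ _
    exact .of_equiv (LinearMap.coprodEquiv (R := Λ) (M := X) (M₂ := Y) (M₃ := I) (Module.End Λ I))
  · intro X Y _ _ _ _ ι π h _
    refine .of_split (LinearMap.lcomp (Module.End Λ I) I π) (LinearMap.lcomp (Module.End Λ I) I ι) ?_
    ext f x
    exact congrArg f (LinearMap.congr_fun h x)

theorem DomdimGE.biEval_bijective (hI : Module.Injective Λ I) {Z : Type u} [AddCommGroup Z]
    [Module Λ Z] (hZ : DomdimGE Λ I 2 Z) : Function.Bijective (biEval Λ (Module.End Λ I) I Z) := by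
  obtain ⟨W, C, _, _, _, _, f, g, hW, hfg, W', C', _, _, _, _, i, p, hW', hip, -⟩ := hZ
  refine biEval_bijective_of_exact (g := i ∘ₗ g) hfg.injective (fun w => ?_) (fun φ => ?_)
    hW.biEval_injective_bijective hW'.biEval_injective_bijective.1
  · rw [← hfg.exact w, LinearMap.comp_apply, map_eq_zero_iff i hip.injective]
  · obtain ⟨ψ, hψ⟩ := hI.out f hfg.injective φ
    exact ⟨ψ, LinearMap.ext hψ⟩

theorem IsShortExact.dual (hI : Module.Injective Λ I) {X Y Z : Type u} [AddCommGroup X] [Module Λ X]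
    [AddCommGroup Y] [Module Λ Y] [AddCommGroup Z] [Module Λ Z] {f : X →ₗ[Λ] Y} {g : Y →ₗ[Λ] Z}
    (h : IsShortExact f g) : IsShortExact (LinearMap.lcomp (Module.End Λ I) I g)
      (LinearMap.lcomp (Module.End Λ I) I f) := by
  refine ⟨fun φ ψ hφ => ?_, fun φ => ⟨fun hφ => ?_, ?_⟩, fun φ => ?_⟩
  · ext z
    obtain ⟨y, rfl⟩ := h.surjective z
    exact LinearMap.congr_fun hφ y
  · exact h.exists_desc φ hφ
  · rintro ⟨φ, rfl⟩
    ext x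
    exact (congrArg φ (h.apply_apply x)).trans (map_zero φ)
  · obtain ⟨ψ, hψ⟩ := hI.out f h.injective φ
    exact ⟨ψ, LinearMap.ext hψ⟩

theorem DomdimGE.extVanishes_dual_iff (hI : Module.Injective Λ I) {Y : Type u} [AddCommGroup Y]
    [Module Λ Y] {i : ℕ} {Z : Type u} [AddCommGroup Z] [Module Λ Z] (hi : 1 ≤ i)
    (hZ : DomdimGE Λ I (i + 2) Z) :
    ExtVanishes (Module.End Λ I) (Z →ₗ[Λ] I) (Y →ₗ[Λ] I) i ↔ ExtVanishes Λ Y Z i := by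
  induction i, hi using Nat.le_induction generalizing Z with
  | base =>
    obtain ⟨W, C, _, _, _, _, f, g, hW, hfg, hC⟩ := hZ
    have hC := hC.biEval_bijective hI
    have hd := hfg.dual hI
    have := hW.projective_dual
    constructor
    · intro h
      refine hfg.extVanishes_one_right (extVanishes_of_injective (hW.injective hI) le_rfl)
        fun φ => ?_
      obtain ⟨ψ, hψ⟩ := hd.exists_extend h (LinearMap.lcomp (Module.End Λ I) I φ)
      obtain ⟨ψ', hψ'⟩ := exists_of_dual hW.biEval_injective_bijective ψ
      refine ⟨ψ', LinearMap.ext fun y => hC.1 (LinearMap.ext fun k => ?_)⟩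
      exact (hψ' (k ∘ₗ g) y).trans (LinearMap.congr_fun (LinearMap.congr_fun hψ k) y)
    · intro h
      refine hd.extVanishes_one_left (extVanishes_of_projective le_rfl) fun φ => ?_
      obtain ⟨φ', hφ'⟩ := exists_of_dual hC φ
      obtain ⟨ψ', rfl⟩ := hfg.exists_lift h φ'
      exact ⟨LinearMap.lcomp (Module.End Λ I) I ψ', LinearMap.ext fun k => LinearMap.ext (hφ' k)⟩
  | succ i hi ih =>
    obtain ⟨W, C, _, _, _, _, f, g, hW, hfg, hC⟩ := hZ
    have hd := hfg.dual hI
    have := hW.projective_dual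
    have hWI := hW.injective hI
    have ih := ih hC
    constructor
    · intro h
      exact hfg.extVanishes_right₁ Y (ih.1 (hd.extVanishes_left₁ _ (extVanishes_of_projective hi) h))
        (extVanishes_of_injective hWI (by omega))
    · intro h
      exact hd.extVanishes_left₃ _ (ih.2 (hfg.extVanishes_right₃ Y
        (extVanishes_of_injective hWI hi) h)) (extVanishes_of_projective (by omega))

end Transfer

section Schanuel

variable {A : Type u} [Ring A] {X Y Z X' Y' Z' : Type u} [AddCommGroup X] [Module A X]
  [AddCommGroup Y] [Module A Y] [AddCommGroup Z] [Module A Z] [AddCommGroup X'] [Module A X']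
  [AddCommGroup Y'] [Module A Y'] [AddCommGroup Z'] [Module A Z']

namespace IsShortExact

theorem nonempty_equiv_left {f : X →ₗ[A] Y} {f' : X' →ₗ[A] Y} {g : Y →ₗ[A] Z}
    (h : IsShortExact f g) (h' : IsShortExact f' g) : Nonempty (X ≃ₗ[A] X') := by
  obtain ⟨a, ha⟩ := h'.exists_factor f h.comp_eq_zero
  obtain ⟨b, hb⟩ := h.exists_factor f' h'.comp_eq_zero
  replace ha := LinearMap.congr_fun ha
  replace hb := LinearMap.congr_fun hb
  simp only [LinearMap.comp_apply] at ha hb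
  exact ⟨.ofLinearMap a b (LinearMap.ext fun x => h'.injective (by simp [ha, hb]))
    (LinearMap.ext fun x => h.injective (by simp [ha, hb]))⟩

theorem nonempty_equiv_right {f : X →ₗ[A] Y} {g : Y →ₗ[A] Z} {g' : Y →ₗ[A] Z'}
    (h : IsShortExact f g) (h' : IsShortExact f g') : Nonempty (Z ≃ₗ[A] Z') := by
  obtain ⟨a, ha⟩ := h.exists_desc g' h'.comp_eq_zero
  obtain ⟨b, hb⟩ := h'.exists_desc g h.comp_eq_zero
  replace ha := LinearMap.congr_fun ha
  replace hb := LinearMap.congr_fun hb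
  simp only [LinearMap.comp_apply] at ha hb
  refine ⟨.ofLinearMap a b (LinearMap.ext fun z => ?_) (LinearMap.ext fun z => ?_)⟩
  · obtain ⟨y, rfl⟩ := h'.surjective z
    simp [ha, hb]
  · obtain ⟨y, rfl⟩ := h.surjective z
    simp [ha, hb]

theorem prodMap {f : X →ₗ[A] Y} {g : Y →ₗ[A] Z} {f' : X' →ₗ[A] Y'} {g' : Y' →ₗ[A] Z'}
    (h : IsShortExact f g) (h' : IsShortExact f' g') :
    IsShortExact (f.prodMap f') (g.prodMap g') := by
  refine ⟨h.injective.prodMap h'.injective, ?_, h.surjective.prodMap h'.surjective⟩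
  rintro ⟨y, y'⟩
  simp [Prod.ext_iff, h.exact y, h'.exact y']

theorem schanuel_aux {f : X →ₗ[A] Y} {g : Y →ₗ[A] Z} (h : IsShortExact f g)
    (g' : Y' →ₗ[A] Z) (s : Y' →ₗ[A] Y) (hs : g ∘ₗ s = g') :
    IsShortExact ((f ∘ₗ LinearMap.fst A X Y' - s ∘ₗ LinearMap.snd A X Y').prod
      (LinearMap.snd A X Y')) (g.coprod g') := by
  subst hs
  refine ⟨?_, ?_, fun z => ?_⟩
  · rw [injective_iff_map_eq_zero]
    rintro ⟨x, y⟩ hxy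
    obtain ⟨h₁, h₂ : y = 0⟩ := Prod.ext_iff.1 hxy
    subst h₂
    simpa [map_eq_zero_iff f h.injective] using h₁
  · rintro ⟨y, y'⟩
    constructor
    · intro hy
      obtain ⟨x, hx⟩ := (h.exact (y + s y')).1 (by simpa using hy)
      exact ⟨(x, y'), by simp [hx]⟩
    · rintro ⟨⟨x, y''⟩, hx⟩
      obtain ⟨rfl, rfl⟩ := Prod.ext_iff.1 hx
      simp [h.apply_apply]
  · obtain ⟨y, rfl⟩ := h.surjective z
    exact ⟨(y, 0), by simp⟩

/-- Schanuel's lemma. -/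
theorem schanuel [Module.Projective A Y] [Module.Projective A Y'] {f : X →ₗ[A] Y} {g : Y →ₗ[A] Z}
    {f' : X' →ₗ[A] Y'} {g' : Y' →ₗ[A] Z} (h : IsShortExact f g) (h' : IsShortExact f' g') :
    Nonempty ((X × Y') ≃ₗ[A] (X' × Y)) := by
  obtain ⟨s, hs⟩ := Module.projective_lifting_property g g' h.surjective
  obtain ⟨s', hs'⟩ := Module.projective_lifting_property g' g h'.surjective
  have h₁ := h.schanuel_aux g' s hs
  have h₂ := h'.schanuel_aux g s' hs'
  let e := LinearEquiv.prodComm A Y Y'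
  have h₃ : IsShortExact (e.symm.toLinearMap ∘ₗ
      ((f' ∘ₗ LinearMap.fst A X' Y - s' ∘ₗ LinearMap.snd A X' Y).prod (LinearMap.snd A X' Y)))
      (g.coprod g') := by
    have : g.coprod g' = g'.coprod g ∘ₗ e.toLinearMap := by ext <;> simp [e]
    rw [this]
    refine ⟨e.symm.injective.comp h₂.injective, fun y => (h₂.exact (e y)).trans ?_,
      h₂.surjective.comp e.surjective⟩
    simp [Set.mem_range, LinearEquiv.symm_apply_eq]
  exact h₁.nonempty_equiv_left h₃

theorem schanuel_dual_aux {f : X →ₗ[A] Y} {g : Y →ₗ[A] Z} (h : IsShortExact f g)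
    (f' : X →ₗ[A] Y') (s : Y →ₗ[A] Y') (hs : s ∘ₗ f = f') :
    IsShortExact (f.prod f') ((g ∘ₗ LinearMap.fst A Y Y').prod
      (LinearMap.snd A Y Y' - s ∘ₗ LinearMap.fst A Y Y')) := by
  subst hs
  refine ⟨fun x x' hx => h.injective (Prod.ext_iff.1 hx).1, ?_, ?_⟩
  · rintro ⟨y, y'⟩
    constructor
    · intro hy
      obtain ⟨h₁, h₂⟩ := Prod.ext_iff.1 hy
      obtain ⟨x, rfl⟩ := (h.exact y).1 h₁
      exact ⟨x, Prod.ext rfl (sub_eq_zero.1 h₂).symm⟩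
    · rintro ⟨x, hx⟩
      obtain ⟨rfl, rfl⟩ := Prod.ext_iff.1 hx
      simp [h.apply_apply]
  · rintro ⟨z, y'⟩
    obtain ⟨y, rfl⟩ := h.surjective z
    exact ⟨(y, y' + s y), by simp⟩

/-- The dual of Schanuel's lemma. -/
theorem schanuel_dual (hY : Module.Injective A Y) (hY' : Module.Injective A Y')
    {f : X →ₗ[A] Y} {g : Y →ₗ[A] Z} {f' : X →ₗ[A] Y'} {g' : Y' →ₗ[A] Z'}
    (h : IsShortExact f g) (h' : IsShortExact f' g') :
    Nonempty ((Z × Y') ≃ₗ[A] (Z' × Y)) := by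
  obtain ⟨s, hs⟩ := hY'.out f h.injective f'
  obtain ⟨s', hs'⟩ := hY.out f' h'.injective f
  have h₁ := h.schanuel_dual_aux f' s (LinearMap.ext hs)
  have h₂ := h'.schanuel_dual_aux f s' (LinearMap.ext hs')
  let e := LinearEquiv.prodComm A Y Y'
  have h₃ : IsShortExact (f.prod f') (((g' ∘ₗ LinearMap.fst A Y' Y).prod
      (LinearMap.snd A Y' Y - s' ∘ₗ LinearMap.fst A Y' Y)) ∘ₗ e.toLinearMap) := by
    refine ⟨h₁.injective, fun y => (h₂.exact (e y)).trans ?_, h₂.surjective.comp e.surjective⟩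
    simp [Set.mem_range, e, Prod.ext_iff, and_comm]
  exact h₁.nonempty_equiv_right h₃

theorem nonempty_equiv_prod [Module.Projective A Z] {f : X →ₗ[A] Y} {g : Y →ₗ[A] Z}
    (h : IsShortExact f g) : Nonempty (Y ≃ₗ[A] (X × Z)) := by
  obtain ⟨s, hs⟩ := Module.projective_lifting_property g .id h.surjective
  replace hs := LinearMap.congr_fun hs
  refine ⟨(LinearEquiv.ofBijective (f.coprod s) ⟨?_, fun y => ?_⟩).symm⟩
  · rw [injective_iff_map_eq_zero]
    rintro ⟨x, z⟩ hxz
    have hz : z = 0 := by simpa [h.apply_apply, show g (s z) = z from hs z] using congrArg g hxz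
    subst hz
    simpa [map_eq_zero_iff f h.injective] using hxz
  · obtain ⟨x, hx⟩ := (h.exact (y - s (g y))).1 (by
      rw [map_sub, show g (s (g y)) = g y from hs (g y), sub_self])
    exact ⟨(x, g y), by simp [hx]⟩

end IsShortExact

end Schanuel

section PdLE

variable {Λ : Type u} [Ring Λ]

/-- All groups `Ext^i(X, -)` with `i > d` vanish. -/
def PdLE (Λ : Type u) [Ring Λ] (d : ℕ) (X : Type u) [AddCommGroup X] [Module Λ X] : Prop :=
  ∀ i > d, ∀ (N : Type u) [AddCommGroup N] [Module Λ N], ExtVanishes Λ X N i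

variable {X Y Z : Type u} [AddCommGroup X] [Module Λ X] [AddCommGroup Y] [Module Λ Y]
  [AddCommGroup Z] [Module Λ Z] {d e : ℕ}

theorem PdLE.mono (h : PdLE Λ d X) (hde : d ≤ e) : PdLE Λ e X :=
  fun i hi N _ _ => h i (by omega) N

theorem pdLE_of_projective [Module.Projective Λ X] : PdLE Λ d X :=
  fun _ hi _ _ _ => extVanishes_of_projective (by omega)

theorem PdLE.retract (h : PdLE Λ d Y) (ι : X →ₗ[Λ] Y) (π : Y →ₗ[Λ] X)
    (hπ : π ∘ₗ ι = LinearMap.id) : PdLE Λ d X :=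
  fun i hi N _ _ => (h i hi N).retract_left ι π hπ

theorem IsShortExact.pdLE_left {f : X →ₗ[Λ] Y} {g : Y →ₗ[Λ] Z} (h : IsShortExact f g)
    (hY : PdLE Λ d Y) (hZ : PdLE Λ (d + 1) Z) : PdLE Λ d X :=
  fun i hi N _ _ => h.extVanishes_left₁ N (hY i hi N) (hZ (i + 1) (by omega) N)

theorem IsShortExact.pdLE_middle {f : X →ₗ[Λ] Y} {g : Y →ₗ[Λ] Z} (h : IsShortExact f g)
    (hX : PdLE Λ d X) (hZ : PdLE Λ d Z) : PdLE Λ d Y :=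
  fun i hi N _ _ => h.extVanishes_left₂ N (hX i hi N) (hZ i hi N)

theorem IsShortExact.pdLE_right {f : X →ₗ[Λ] Y} {g : Y →ₗ[Λ] Z} (h : IsShortExact f g)
    (hX : PdLE Λ d X) (hY : PdLE Λ (d + 1) Y) : PdLE Λ (d + 1) Z := by
  rintro (_ | i) hi N
  · omega
  · exact h.extVanishes_left₃ N (hX i (by omega) N) (hY (i + 1) hi N)

theorem InAdd.pdLE {M : Type u} [AddCommGroup M] [Module Λ M] (hM : PdLE Λ d M)
    (hX : InAdd Λ M X) : PdLE Λ d X :=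
  hX.induction (P := fun X _ _ => PdLE Λ d X) hM pdLE_of_projective
    (fun _ _ _ _ _ _ hX hY => isShortExact_inl_snd.pdLE_middle hX hY)
    (fun _ _ _ _ _ _ ι π h hY => hY.retract ι π h)

theorem PdLE.projective (h : PdLE Λ 0 X) [Module.Finite Λ X] : Module.Projective Λ X := by
  obtain ⟨m, p, hp⟩ := Module.Finite.exists_fin' Λ X
  obtain ⟨s, hs⟩ := (isShortExact_subtype hp).exists_lift (h 1 one_pos _) .id
  exact .of_split s p hs

end PdLE

section Euler

variable {Λ : Type u} [Ring Λ] {V : Type*} [AddCommGroup V]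

/-- An additive invariant of finitely generated projective modules. -/
structure AdditiveInvariant (Λ : Type u) [Ring Λ] (V : Type*) [AddCommGroup V] where
  /-- The value of the invariant. -/
  val : ∀ (P : Type u) [AddCommGroup P] [Module Λ P], V
  congr : ∀ {P Q : Type u} [AddCommGroup P] [Module Λ P] [AddCommGroup Q] [Module Λ Q],
    (P ≃ₗ[Λ] Q) → val P = val Q
  prod : ∀ {P Q : Type u} [AddCommGroup P] [Module Λ P] [AddCommGroup Q] [Module Λ Q]
    [Module.Finite Λ P] [Module.Finite Λ Q] [Module.Projective Λ P] [Module.Projective Λ Q],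
    val (P × Q) = val P + val Q

namespace AdditiveInvariant

variable (v : AdditiveInvariant Λ V)

theorem val_punit : v.val PUnit.{u + 1} = 0 := by
  have h := v.prod (P := PUnit.{u + 1}) (Q := PUnit.{u + 1})
  rw [v.congr (LinearEquiv.ofSubsingleton (PUnit.{u + 1} × PUnit.{u + 1}) PUnit.{u + 1})] at h
  simpa using h

/-- `x` is the alternating sum of the values of `v` on a projective resolution of `W` of
length `d`. -/
def EulerChar : ℕ → ∀ (W : Type u) [AddCommGroup W] [Module Λ W], V → Prop
  | 0, W, _, _, x => Module.Finite Λ W ∧ Module.Projective Λ W ∧ x = v.val W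
  | d + 1, W, _, _, x => ∃ (K P : Type u) (_ : AddCommGroup K) (_ : Module Λ K)
      (_ : AddCommGroup P) (_ : Module Λ P) (f : K →ₗ[Λ] P) (g : P →ₗ[Λ] W) (y : V),
      Module.Finite Λ P ∧ Module.Projective Λ P ∧ IsShortExact f g ∧ EulerChar d K y ∧
      x = v.val P - y

variable {v} {W W' Q : Type u} [AddCommGroup W] [Module Λ W] [AddCommGroup W'] [Module Λ W']
  [AddCommGroup Q] [Module Λ Q] {d e : ℕ} {x x' : V}

theorem EulerChar.congr (h : v.EulerChar d W x) (e : W ≃ₗ[Λ] W') : v.EulerChar d W' x := by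
  cases d with
  | zero =>
    obtain ⟨_, _, rfl⟩ := h
    exact ⟨.equiv e, .of_equiv e, v.congr e⟩
  | succ d =>
    obtain ⟨K, P, _, _, _, _, f, g, y, hP, hP', hfg, hK, rfl⟩ := h
    exact ⟨K, P, _, _, _, _, f, e.toLinearMap ∘ₗ g, y, hP, hP', ⟨hfg.injective, fun p => by
      rw [← hfg.exact p]; simp, e.surjective.comp hfg.surjective⟩, hK, rfl⟩

theorem EulerChar.prod (h : v.EulerChar d W x) [Module.Finite Λ Q] [Module.Projective Λ Q] :
    v.EulerChar d (W × Q) (x + v.val Q) := by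
  cases d with
  | zero =>
    obtain ⟨_, _, rfl⟩ := h
    exact ⟨inferInstance, inferInstance, v.prod.symm⟩
  | succ d =>
    obtain ⟨K, P, _, _, _, _, f, g, y, hP, hP', hfg, hK, rfl⟩ := h
    refine ⟨K, P × Q, _, _, _, _, LinearMap.inl Λ P Q ∘ₗ f, g.prodMap .id, y, inferInstance,
      inferInstance, ⟨LinearMap.inl_injective.comp hfg.injective, ?_,
      hfg.surjective.prodMap Function.surjective_id⟩, hK, by rw [v.prod]; abel⟩
    rintro ⟨p, q⟩
    simp [Prod.ext_iff, hfg.exact p, eq_comm (a := q)]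

theorem EulerChar.succ (h : v.EulerChar d W x) : v.EulerChar (d + 1) W x := by
  induction d generalizing W x with
  | zero =>
    obtain ⟨hf, hp, rfl⟩ := h
    exact ⟨PUnit, W, _, _, _, _, 0, .id, 0, hf, hp, ⟨Function.injective_of_subsingleton _,
      fun p => by simp [eq_comm], Function.surjective_id⟩,
      ⟨inferInstance, inferInstance, v.val_punit.symm⟩, by simp⟩
  | succ d ih =>
    obtain ⟨K, P, _, _, _, _, f, g, y, hP, hP', hfg, hK, rfl⟩ := h
    exact ⟨K, P, _, _, _, _, f, g, y, hP, hP', hfg, ih hK, rfl⟩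

theorem EulerChar.mono (h : v.EulerChar d W x) (hde : d ≤ e) : v.EulerChar e W x := by
  induction e, hde using Nat.le_induction with
  | base => exact h
  | succ e _ ih => exact ih.succ

theorem EulerChar.unique (h : v.EulerChar d W x) (h' : v.EulerChar e W x') : x = x' := by
  replace h := h.mono (le_max_left d e)
  replace h' := h'.mono (le_max_right d e)
  generalize max d e = m at h h'
  induction m generalizing W x x' with
  | zero => rw [h.2.2, h'.2.2]
  | succ m ih =>
    obtain ⟨K, P, _, _, _, _, f, g, y, hP, hP₁, hfg, hK, rfl⟩ := h
    obtain ⟨K', P', _, _, _, _, f', g', y', hP', hP₁', hfg', hK', rfl⟩ := h'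
    obtain ⟨e⟩ := hfg.schanuel hfg'
    have := ih (hK.prod.congr e) hK'.prod
    rw [sub_eq_sub_iff_add_eq_add, add_comm, ← this, add_comm]

theorem EulerChar.extension {f : W →ₗ[Λ] Q} {g : Q →ₗ[Λ] W'} (hfg : IsShortExact f g)
    (h : v.EulerChar d W x) (h' : v.EulerChar e W' x') :
    v.EulerChar (max d e) Q (x + x') := by
  replace h := h.mono (le_max_left d e)
  replace h' := h'.mono (le_max_right d e)
  generalize max d e = m at h h'
  induction m generalizing W W' Q x x' with
  | zero =>
    obtain ⟨_, _, rfl⟩ := h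
    obtain ⟨_, _, rfl⟩ := h'
    obtain ⟨e⟩ := hfg.nonempty_equiv_prod
    exact EulerChar.congr (d := 0) ⟨inferInstance, inferInstance, v.prod.symm⟩ e.symm
  | succ m ih =>
    obtain ⟨K, P, _, _, _, _, i, p, y, _, _, hip, hK, rfl⟩ := h
    obtain ⟨K', P', _, _, _, _, i', p', y', _, _, hip', hK', rfl⟩ := h'
    obtain ⟨s, hs⟩ := Module.projective_lifting_property g p' hfg.surjective
    have hs' := LinearMap.congr_fun hs
    have hsurj : Function.Surjective ((f ∘ₗ p).coprod s) := by
      intro q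
      obtain ⟨b, hb⟩ := hip'.surjective (g q)
      obtain ⟨w, hw⟩ := (hfg.exact (q - s b)).1 (by
        rw [map_sub, ← hb, show g (s b) = p' b from hs' b, sub_self])
      obtain ⟨a, rfl⟩ := hip.surjective w
      exact ⟨(a, b), by simp [hw]⟩
    obtain ⟨f', g', h'⟩ := isShortExact_inl_snd.exists_kernel_row hfg hip
      (isShortExact_subtype hsurj) hip' (by ext; simp) (by
        ext b
        · simp [hfg.apply_apply]
        · simpa using hs' b)
    exact ⟨_, P × P', _, _, _, _, _, _, _, inferInstance, inferInstance,
      isShortExact_subtype hsurj, ih h' hK hK', by rw [v.prod]; abel⟩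

theorem exists_eulerChar [IsNoetherianRing Λ] (v : AdditiveInvariant Λ V) [Module.Finite Λ W]
    (h : PdLE Λ d W) : ∃ x, v.EulerChar d W x := by
  induction d generalizing W with
  | zero => exact ⟨_, inferInstance, h.projective, rfl⟩
  | succ d ih =>
    obtain ⟨m, p, hp⟩ := Module.Finite.exists_fin' Λ W
    obtain ⟨y, hy⟩ := ih ((isShortExact_subtype hp).pdLE_left pdLE_of_projective h)
    exact ⟨_, _, _, _, _, _, _, _, p, y, inferInstance, inferInstance, isShortExact_subtype hp, hy,
      rfl⟩

end AdditiveInvariant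

end Euler

section FinCoresolution

variable {Λ : Type u} [Ring Λ]

/-- There is an exact sequence `0 → Q → W_0 → ⋯ → W_m → 0` with all `W_i ∈ add T`. -/
def FinCores (Λ : Type u) [Ring Λ] (T : Type u) [AddCommGroup T] [Module Λ T] :
    ℕ → ∀ (Q : Type u) [AddCommGroup Q] [Module Λ Q], Prop
  | 0, Q, _, _ => InAdd Λ T Q
  | m + 1, Q, _, _ => ∃ (W C : Type u) (_ : AddCommGroup W) (_ : Module Λ W) (_ : AddCommGroup C)
      (_ : Module Λ C) (f : Q →ₗ[Λ] W) (g : W →ₗ[Λ] C), InAdd Λ T W ∧ IsShortExact f g ∧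
      FinCores Λ T m C

variable {T : Type u} [AddCommGroup T] [Module Λ T] {m : ℕ} {Q Q' : Type u} [AddCommGroup Q]
  [Module Λ Q] [AddCommGroup Q'] [Module Λ Q']

theorem FinCores.congr (h : FinCores Λ T m Q') (e : Q ≃ₗ[Λ] Q') : FinCores Λ T m Q := by
  cases m with
  | zero => exact InAdd.congr h e
  | succ m =>
    obtain ⟨W, C, _, _, _, _, f, g, hW, hfg, hC⟩ := h
    exact ⟨W, C, _, _, _, _, f ∘ₗ e.toLinearMap, g, hW, ⟨hfg.injective.comp e.injective,
      fun w => (hfg.exact w).trans (by simp [e.surjective.range_comp]), hfg.surjective⟩, hC⟩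

theorem FinCores.prod (h : FinCores Λ T m Q) (hQ' : InAdd Λ T Q') : FinCores Λ T m (Q × Q') := by
  cases m with
  | zero => exact InAdd.prod h hQ'
  | succ m =>
    obtain ⟨W, C, _, _, _, _, f, g, hW, hfg, hC⟩ := h
    refine ⟨W × Q', C, _, _, _, _, f.prodMap .id, g ∘ₗ LinearMap.fst Λ W Q', hW.prod hQ',
      ⟨hfg.injective.prodMap Function.injective_id, ?_,
      hfg.surjective.comp Prod.fst_surjective⟩, hC⟩
    rintro ⟨w, q⟩
    simp [hfg.exact w]

theorem FinCores.retract (hT : Module.Injective Λ T) (h : FinCores Λ T m Q') (ι : Q →ₗ[Λ] Q')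
    (π : Q' →ₗ[Λ] Q) (hπ : π ∘ₗ ι = LinearMap.id) : FinCores Λ T m Q := by
  induction m generalizing Q Q' with
  | zero => exact InAdd.retract h ι π hπ
  | succ m ih =>
    obtain ⟨W, C, _, _, _, _, f, g, hW, hfg, hC⟩ := h
    have hπ' := LinearMap.congr_fun hπ
    simp only [LinearMap.comp_apply, LinearMap.id_apply] at hπ'
    have hι : Function.Injective ι := Function.LeftInverse.injective hπ'
    let κ := (LinearMap.ker π).subtype
    have h₁ : IsShortExact (f ∘ₗ ι) _ := isShortExact_mkQ (hfg.injective.comp hι)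
    have h₂ : IsShortExact (f ∘ₗ κ) _ :=
      isShortExact_mkQ (hfg.injective.comp (Submodule.injective_subtype _))
    let e : (Q × LinearMap.ker π) ≃ₗ[Λ] Q' := LinearEquiv.ofBijective (ι.coprod κ) <| by
      constructor
      · rw [injective_iff_map_eq_zero]
        rintro ⟨q, k⟩ hq
        have hq₀ : q = 0 := by simpa [hπ', κ] using congrArg π hq
        subst hq₀
        simpa [κ] using hq
      · intro q
        exact ⟨(π q, ⟨q - ι (π q), by simp [hπ']⟩), by simp [κ]⟩
    have h₃ : IsShortExact (f ∘ₗ e.toLinearMap) g := ⟨hfg.injective.comp e.injective,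
      fun w => (hfg.exact w).trans (by simp [e.surjective.range_comp]), hfg.surjective⟩
    have hWI := hW.injective hT
    obtain ⟨s⟩ := (h₁.prodMap h₂).schanuel_dual ((hW.prod hW).injective hT) hWI h₃
    have hD := (hC.prod (hW.prod hW)).congr s
    exact ⟨W, _, _, _, _, _, f ∘ₗ ι, _, hW, h₁, ih hD
      (LinearMap.inl Λ _ W ∘ₗ LinearMap.inl Λ _ _)
      (LinearMap.fst Λ _ _ ∘ₗ LinearMap.fst Λ _ W) (by ext; simp)⟩

theorem AdditiveInvariant.EulerChar.mem_of_finCores [IsNoetherianRing Λ] {V : Type*}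
    [AddCommGroup V] {v : AdditiveInvariant Λ V} {U : AddSubgroup V} [Module.Finite Λ T] {d : ℕ}
    (hT : PdLE Λ d T)
    (hU : ∀ (W : Type u) [AddCommGroup W] [Module Λ W] (d : ℕ) (x : V), InAdd Λ T W →
      v.EulerChar d W x → x ∈ U)
    [Module.Finite Λ Q] {e : ℕ} (hQe : PdLE Λ e Q) (hQ : FinCores Λ T m Q)
    {b : ℕ} {x : V} (hx : v.EulerChar b Q x) : x ∈ U := by
  induction m generalizing Q e b x with
  | zero => exact hU Q b x hQ hx
  | succ m ih =>
    obtain ⟨W, C, _, _, _, _, f, g, hW, hfg, hC⟩ := hQ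
    have := hW.finite
    have := hfg.finite_right
    have hWd := hW.pdLE hT
    have hCd := hfg.pdLE_right (hQe.mono (le_max_left e d))
      (hWd.mono (by omega : d ≤ max e d + 1))
    obtain ⟨c, hc⟩ := exists_eulerChar v hCd
    have := hU W _ _ hW (EulerChar.extension hfg hx hc)
    exact (U.add_mem_cancel_right (ih hCd hC hc)).1 this

end FinCoresolution

section Envelope

variable {Λ : Type u} [Ring Λ] {T : Type u} [AddCommGroup T] [Module Λ T]

/-- The map `s : S → E` exhibits `E` as the smallest object of `add T` receiving a nonzero map
from `S`: every `W ∈ add T` receiving a nonzero map from `S` has `E` as a direct summand. -/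
structure IsAddEnvelope (Λ : Type u) [Ring Λ] (T : Type u) [AddCommGroup T] [Module Λ T]
    (S E : Type u) [AddCommGroup S] [Module Λ S] [AddCommGroup E] [Module Λ E] : Prop where
  inAdd : InAdd Λ T E
  exists_ne_zero : ∃ s : S →ₗ[Λ] E, s ≠ 0
  exists_retract : ∀ (W : Type u) [AddCommGroup W] [Module Λ W], InAdd Λ T W →
    ∀ φ : S →ₗ[Λ] W, φ ≠ 0 → ∃ (ι : E →ₗ[Λ] W) (π : W →ₗ[Λ] E), π ∘ₗ ι = LinearMap.id

/-- If `E` has the smallest length among the modules in `add T` receiving a nonzero map from the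
simple module `S`, then every endomorphism of `E` fixing such a map is bijective. -/
theorem bijective_of_forall_length_le [IsArtinianRing Λ] {S E : Type u} [AddCommGroup S]
    [Module Λ S] [AddCommGroup E] [Module Λ E] [Module.Finite Λ E] (hE : InAdd Λ T E)
    {s : S →ₗ[Λ] E} (hs : s ≠ 0)
    (hmin : ∀ (W : Type u) [AddCommGroup W] [Module Λ W], InAdd Λ T W →
      (∃ φ : S →ₗ[Λ] W, φ ≠ 0) → Module.length Λ E ≤ Module.length Λ W)
    (h : E →ₗ[Λ] E) (hh : h ∘ₗ s = s) : Function.Bijective h := by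
  obtain ⟨n, hn⟩ := ((LinearMap.eventually_isCompl_ker_pow_range_pow (R := Λ) (M := E) h).and
    (Filter.eventually_ge_atTop 1)).exists
  obtain ⟨hc, hn⟩ := hn
  have hpow : ∀ k x, (h ^ k : Module.End Λ E) (s x) = s x := by
    intro k x
    induction k with
    | zero => rfl
    | succ k ih =>
      rw [pow_succ, Module.End.mul_apply]
      exact (congrArg _ (LinearMap.congr_fun hh x)).trans ih
  have htop : LinearMap.range (h ^ n : Module.End Λ E) = ⊤ := by
    by_contra hne
    refine (Submodule.length_lt hne).not_ge (hmin _ (hE.retract (Submodule.subtype _)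
      (Submodule.projectionOnto _ _ hc.symm) ?_) ⟨s.codRestrict _ fun x => ⟨s x, hpow n x⟩, ?_⟩)
    · ext x
      simp
    · intro h0
      exact hs (LinearMap.ext fun x => congrArg Subtype.val (LinearMap.congr_fun h0 x))
  rw [htop] at hc
  have hker : LinearMap.ker (h ^ n : Module.End Λ E) = ⊥ := by
    simpa using hc.inf_eq_bot
  apply IsArtinian.bijective_of_injective_endomorphism
  obtain ⟨n, rfl⟩ := Nat.exists_eq_succ_of_ne_zero (by omega : n ≠ 0)
  rw [LinearMap.ker_eq_bot, Nat.succ_eq_add_one, pow_succ] at hker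
  exact Function.Injective.of_comp (f := (h ^ n : Module.End Λ E)) hker

theorem exists_isAddEnvelope [IsArtinianRing Λ] [Module.Finite Λ T] (hT : Module.Injective Λ T)
    {S : Type u} [AddCommGroup S] [Module Λ S] [IsSimpleModule Λ S] {φ : S →ₗ[Λ] T} (hφ : φ ≠ 0) :
    ∃ (E : Type u) (_ : AddCommGroup E) (_ : Module Λ E), IsAddEnvelope Λ T S E := by
  let L : Set ℕ∞ := {l | ∃ (E : Type u) (_ : AddCommGroup E) (_ : Module Λ E), InAdd Λ T E ∧
    (∃ s : S →ₗ[Λ] E, s ≠ 0) ∧ Module.length Λ E = l}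
  have hL : L.Nonempty := ⟨_, T, _, _, inAdd_self, ⟨φ, hφ⟩, rfl⟩
  obtain ⟨E, _, _, hE, ⟨s, hs⟩, hl⟩ := WellFounded.min_mem wellFounded_lt L hL
  have := hE.finite
  refine ⟨E, _, _, hE, ⟨s, hs⟩, fun W _ _ hW ψ hψ => ?_⟩
  obtain ⟨α, hα⟩ := (hW.injective hT).out s (LinearMap.injective_of_ne_zero hs) ψ
  obtain ⟨β, hβ⟩ := (hE.injective hT).out ψ (LinearMap.injective_of_ne_zero hψ) s
  have hbij := bijective_of_forall_length_le hE hs (fun W' _ _ hW' h' => hl ▸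
    WellFounded.min_le wellFounded_lt (s := L) ⟨W', _, _, hW', h', rfl⟩)
    (β ∘ₗ α) (by ext x; simp [hα, hβ])
  refine ⟨α, (LinearEquiv.ofBijective _ hbij).symm.toLinearMap ∘ₗ β, ?_⟩
  ext x
  exact (LinearEquiv.ofBijective _ hbij).symm_apply_apply x

theorem exists_isSimpleModule_submodule [IsArtinianRing Λ] (W : Type u) [AddCommGroup W]
    [Module Λ W] [Module.Finite Λ W] [Nontrivial W] :
    ∃ S : Submodule Λ W, IsSimpleModule Λ S :=
  (IsAtomic.exists_atom (Submodule Λ W)).imp fun _ => isSimpleModule_iff_isAtom.mpr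

/-- The Euler characteristics of the modules in `add T` lie in every subgroup containing those of
the envelopes of the simple modules which embed into `T`. -/
theorem AdditiveInvariant.EulerChar.mem_of_isAddEnvelope [IsArtinianRing Λ] {V : Type*}
    [AddCommGroup V] {v : AdditiveInvariant Λ V} {U : AddSubgroup V} [Module.Finite Λ T]
    (hU : ∀ (S : Type u) [AddCommGroup S] [Module Λ S] [IsSimpleModule Λ S],
      (∃ φ : S →ₗ[Λ] T, φ ≠ 0) → ∃ (E : Type u) (_ : AddCommGroup E) (_ : Module Λ E) (d : ℕ) (x : V),
        IsAddEnvelope Λ T S E ∧ v.EulerChar d E x ∧ x ∈ U) {d' : ℕ}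
    (hT : PdLE Λ d' T) {W : Type u} [AddCommGroup W] [Module Λ W] {d : ℕ} {x : V} (hW : InAdd Λ T W)
    (hx : v.EulerChar d W x) : x ∈ U := by
  have := hW.finite
  obtain ⟨l, hl⟩ : ∃ l : ℕ∞, Module.length Λ W = l := ⟨_, rfl⟩
  induction l using WellFoundedLT.induction generalizing W d x with
  | ind l ih =>
    rcases subsingleton_or_nontrivial W with _ | _
    · have h0 : v.EulerChar 0 W 0 := ⟨this, inferInstance,
        (v.val_punit.symm.trans (v.congr (LinearEquiv.ofSubsingleton PUnit.{u + 1} W)))⟩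
      rw [hx.unique h0]
      exact U.zero_mem
    · obtain ⟨S, hS⟩ := exists_isSimpleModule_submodule (Λ := Λ) W
      have hne : S.subtype ≠ 0 := fun h0 => by
        have := hS.nontrivial
        obtain ⟨y, hy⟩ := exists_ne (0 : S)
        exact hy (Subtype.ext (LinearMap.congr_fun h0 y))
      have hST : ∃ φ : S →ₗ[Λ] T, φ ≠ 0 := by
        obtain ⟨k, ι, π, hπ⟩ := hW
        by_contra! hall
        refine hne (LinearMap.ext fun z => ?_)
        have hz : ι z = 0 := funext fun j =>
          LinearMap.congr_fun (hall (LinearMap.proj j ∘ₗ ι ∘ₗ S.subtype)) z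
        simpa [hz] using (LinearMap.congr_fun hπ z).symm
      obtain ⟨E, _, _, e, x₁, hE, hE₁, hx₁⟩ := hU S hST
      obtain ⟨ι, π, hπ⟩ := hE.exists_retract W hW S.subtype hne
      have hπs : Function.Surjective π := fun z => ⟨ι z, LinearMap.congr_fun hπ z⟩
      have hsh := isShortExact_subtype hπs
      have hK : InAdd Λ T (LinearMap.ker π) :=
        hW.retract (LinearMap.ker π).subtype
          ((LinearMap.id - ι ∘ₗ π).codRestrict _ fun w => by
            simpa [sub_eq_zero] using (LinearMap.congr_fun hπ (π w)).symm)
          (by ext w; simp)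
      have := hK.finite
      have := hE.inAdd.finite
      obtain ⟨x₂, hx₂⟩ := v.exists_eulerChar (hK.pdLE hT)
      have hlt : Module.length Λ (LinearMap.ker π) < l := by
        rw [← hl]
        refine Submodule.length_lt fun htop => ?_
        obtain ⟨s, hs⟩ := hE.exists_ne_zero
        refine hs (LinearMap.ext fun z => ?_)
        have h1 : π (ι (s z)) = s z := LinearMap.congr_fun hπ (s z)
        rw [← h1]
        exact LinearMap.mem_ker.mp (htop ▸ Submodule.mem_top)
      rw [hx.unique (hx₂.extension hsh hE₁)]
      exact U.add_mem (ih _ hlt hK hx₂ inferInstance rfl) hx₁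

end Envelope

section SimpleModules

variable {Λ : Type u} [Ring Λ] [IsArtinianRing Λ]

instance isSemisimpleModule_quotient_jacobson :
    IsSemisimpleModule Λ (Λ ⧸ Ring.jacobson Λ) :=
  (IsArtinian.isSemisimpleModule_iff_jacobson Λ _).mpr (Module.jacobson_quotient_jacobson Λ Λ)

theorem exists_submodule_linearEquiv_of_isSimpleModule (S : Type u) [AddCommGroup S] [Module Λ S]
    [IsSimpleModule Λ S] :
    ∃ S' : Submodule Λ (Λ ⧸ Ring.jacobson Λ), Nonempty (S' ≃ₗ[Λ] S) := by
  have := IsSimpleModule.nontrivial Λ S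
  obtain ⟨s, hs⟩ := exists_ne (0 : S)
  let f := (Ring.jacobson Λ).liftQ (LinearMap.toSpanSingleton Λ S s)
    (IsSemisimpleModule.jacobson_le_ker Λ Λ Λ S _)
  have hf : f ≠ 0 := fun h0 =>
    hs ((one_smul Λ s).symm.trans (LinearMap.congr_fun h0 (Submodule.Quotient.mk 1)))
  obtain ⟨S', ⟨e⟩⟩ := IsSemisimpleModule.exists_submodule_linearEquiv_quotient (LinearMap.ker f)
  exact ⟨S', ⟨e.trans (f.quotKerEquivOfSurjective (LinearMap.surjective_of_ne_zero hf))⟩⟩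

/-- Every simple module has a primitive idempotent which acts nontrivially on it and annihilates
all other simple modules. -/
theorem exists_isIdempotentElem_of_isSimpleModule (S : Submodule Λ (Λ ⧸ Ring.jacobson Λ))
    [IsSimpleModule Λ S] :
    ∃ e : Λ, IsIdempotentElem e ∧ (∃ s : S, s ≠ 0 ∧ e • s = s) ∧
      ∀ (S' : Type u) [AddCommGroup S'] [Module Λ S'] [IsSimpleModule Λ S'] (s : S'), s ≠ 0 →
        e • s = s → Nonempty (S ≃ₗ[Λ] S') := by
  obtain ⟨C, hC⟩ := exists_isCompl S
  let π := Submodule.projectionOnto S C hC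
  let ε : Λ ⧸ Ring.jacobson Λ := (π 1).1
  have hπ : ∀ b : Λ, (π (Ideal.Quotient.mk _ b)).1 = Ideal.Quotient.mk _ b * ε := by
    intro b
    have h1 : Ideal.Quotient.mk (Ring.jacobson Λ) b = b • (1 : Λ ⧸ Ring.jacobson Λ) := by
      rw [← map_one (Ideal.Quotient.mk (Ring.jacobson Λ))]
      exact congrArg _ (mul_one b).symm
    rw [h1, map_smul]
    obtain ⟨c, hc⟩ := Ideal.Quotient.mk_surjective ε
    rw [← h1, ← hc, ← map_mul]
    change b • ε = _
    rw [← hc]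
    rfl
  have hε : IsIdempotentElem ε := by
    obtain ⟨c, hc⟩ := Ideal.Quotient.mk_surjective ε
    have h := hπ c
    rw [hc] at h
    exact h.symm.trans (congrArg Subtype.val (Submodule.projectionOnto_apply_left hC (π 1)))
  have hnil : ∀ x ∈ RingHom.ker (Ideal.Quotient.mk (Ring.jacobson Λ)), IsNilpotent x := by
    intro x hx
    rw [Ideal.mk_ker] at hx
    obtain ⟨m, hm⟩ := IsSemiprimaryRing.isNilpotent (R := Λ)
    exact ⟨m, by simpa [hm] using Ideal.pow_mem_pow hx m⟩
  obtain ⟨e, he, heε⟩ := exists_isIdempotentElem_eq_of_ker_isNilpotent _ hnil ε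
    (Ideal.Quotient.mk_surjective ε) hε
  have heπ : e • π 1 = π 1 := Subtype.ext <| by
    change e • ε = ε
    conv_rhs => rw [← hε.eq, ← heε]
    rw [← heε]
    rfl
  refine ⟨e, he, ⟨π 1, fun h0 => ?_, heπ⟩, fun S' _ _ _ s hs hes => ?_⟩
  · have := IsSimpleModule.nontrivial Λ S
    obtain ⟨y, hy⟩ := exists_ne (0 : S)
    obtain ⟨b, hb⟩ := Ideal.Quotient.mk_surjective y.1
    refine hy (Subtype.ext ?_)
    have h := hπ b
    rw [hb, show ε = 0 from congrArg Subtype.val h0, mul_zero,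
      Submodule.projectionOnto_apply_left hC y] at h
    exact h
  · let g := (Ring.jacobson Λ).liftQ (LinearMap.toSpanSingleton Λ S' s)
      (IsSemisimpleModule.jacobson_le_ker Λ Λ Λ S' _)
    have hg : g ∘ₗ S.subtype ≠ 0 := fun h0 => hs <| by
      have h := LinearMap.congr_fun h0 (π 1)
      change g ε = 0 at h
      rw [← heε] at h
      exact hes.symm.trans h
    exact ⟨LinearEquiv.ofBijective _ (LinearMap.bijective_of_ne_zero hg)⟩

/-- Over an artinian ring there are finitely many simple modules `S k`, and projective modules
`P k` having `S k` as their only simple quotient. -/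
theorem exists_simple_projective_family (Λ : Type u) [Ring Λ] [IsArtinianRing Λ] :
    ∃ (κ : Type u) (_ : Finite κ) (S : κ → Submodule Λ (Λ ⧸ Ring.jacobson Λ))
      (P : κ → Submodule Λ Λ), (∀ k, IsSimpleModule Λ (S k)) ∧
      (∀ (S' : Type u) [AddCommGroup S'] [Module Λ S'] [IsSimpleModule Λ S'],
        ∃ k, Nonempty (S k ≃ₗ[Λ] S')) ∧
      (∀ k, ∃ π : Λ →ₗ[Λ] P k, π ∘ₗ (P k).subtype = LinearMap.id) ∧
      (∀ k, ∃ f : P k →ₗ[Λ] S k, f ≠ 0) ∧ ∀ k j (f : P k →ₗ[Λ] S j), f ≠ 0 → k = j := by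
  choose S hS hS' using fun k : isotypicComponents Λ (Λ ⧸ Ring.jacobson Λ) => k.2
  choose e he hes heu using fun k => exists_isIdempotentElem_of_isSimpleModule (S k)
  refine ⟨isotypicComponents Λ (Λ ⧸ Ring.jacobson Λ), inferInstance, S,
    fun k => LinearMap.range (LinearMap.toSpanSingleton Λ Λ (e k)), hS, ?_, fun k => ?_,
    fun k => ?_, fun k j f hf => ?_⟩
  · intro S' _ _ _
    obtain ⟨S₁, ⟨φ⟩⟩ := exists_submodule_linearEquiv_of_isSimpleModule (Λ := Λ) S'
    have := IsSimpleModule.congr φ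
    let k : isotypicComponents Λ (Λ ⧸ Ring.jacobson Λ) := ⟨_, S₁, this, rfl⟩
    have hk : isotypicComponent Λ (Λ ⧸ Ring.jacobson Λ) S₁ =
      isotypicComponent Λ (Λ ⧸ Ring.jacobson Λ) (S k) := hS' k
    have hle : S₁ ≤ isotypicComponent Λ (Λ ⧸ Ring.jacobson Λ) (S k) :=
      hk ▸ S₁.le_isotypicComponent
    obtain ⟨ψ⟩ := isIsotypicOfType_submodule_iff.mp
      (IsIsotypicOfType.isotypicComponent Λ _ (S k)) S₁ hle
    exact ⟨k, ⟨ψ.symm.trans φ⟩⟩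
  · refine ⟨(LinearMap.toSpanSingleton Λ Λ (e k)).rangeRestrict, ?_⟩
    ext ⟨x, b, rfl⟩
    simp [mul_assoc, (he k).eq]
  · obtain ⟨s, hs, hs'⟩ := hes k
    refine ⟨LinearMap.toSpanSingleton Λ (S k) s ∘ₗ Submodule.subtype _, fun h0 => hs ?_⟩
    have h := LinearMap.congr_fun h0 ⟨e k, 1, by simp⟩
    exact hs'.symm.trans h
  · let p : Λ →ₗ[Λ] LinearMap.range (LinearMap.toSpanSingleton Λ Λ (e k)) :=
      (LinearMap.toSpanSingleton Λ Λ (e k)).rangeRestrict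
    have hp : ∀ b, p b = b • p 1 := fun b => by rw [← map_smul, smul_eq_mul, mul_one]
    have hs : f (p 1) ≠ 0 := fun h0 => hf <| LinearMap.ext fun x => by
      obtain ⟨b, rfl⟩ := LinearMap.surjective_rangeRestrict _ x
      change f (p b) = 0
      rw [hp, map_smul, h0, smul_zero]
    have hes' : e k • f (p 1) = f (p 1) := by
      rw [← map_smul, ← hp]
      exact congrArg f (Subtype.ext (by simp [p, (he k).eq]))
    obtain ⟨φ⟩ := heu k (S j) _ hs hes'
    exact Subtype.ext ((hS' k).trans (φ.isotypicComponent_eq.trans (hS' j).symm))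

end SimpleModules

section Counting

variable (R : Type u) [CommRing R] {Λ : Type u} [Ring Λ] [Algebra R Λ]

theorem finite_linearMap [IsNoetherianRing R] (X Y : Type u) [AddCommGroup X] [Module Λ X]
    [Module.Finite Λ X] [AddCommGroup Y] [Module Λ Y] [Module R Y] [IsScalarTower R Λ Y]
    [Module.Finite R Y] : Module.Finite R (X →ₗ[Λ] Y) := by
  obtain ⟨m, p, hp⟩ := Module.Finite.exists_fin' Λ X
  let F : (X →ₗ[Λ] Y) →ₗ[R] (Fin m → Y) :=
    LinearMap.pi fun j => LinearMap.applyₗ' R (p (Pi.single j 1))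
  refine Module.Finite.of_injective F fun φ ψ h => ?_
  have : φ ∘ₗ p = ψ ∘ₗ p := by
    ext j
    exact congrFun h j
  exact LinearMap.ext fun x => by
    obtain ⟨w, rfl⟩ := hp x
    exact LinearMap.congr_fun this w

theorem finite_linearMap_submodule [IsNoetherianRing R] (X : Type u) {N : Type u}
    [AddCommGroup X] [Module Λ X] [Module.Finite Λ X] [AddCommGroup N] [Module Λ N] [Module R N]
    [IsScalarTower R Λ N] [Module.Finite R N] (S : Submodule Λ N) :
    Module.Finite R (X →ₗ[Λ] S) :=
  have := Module.Finite.of_injective (S.subtype.restrictScalars R) Subtype.val_injective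
  finite_linearMap (Λ := Λ) R X S

/-- The lengths of the modules `Hom(P, S k)`, as an invariant of the projective module `P`. -/
noncomputable def lengthInvariant [IsArtinianRing R] {κ N : Type u} [AddCommGroup N] [Module Λ N]
    [Module R N] [IsScalarTower R Λ N] [Module.Finite R N] (S : κ → Submodule Λ N) :
    AdditiveInvariant Λ (κ → ℚ) where
  val P _ _ k := ((Module.length R (P →ₗ[Λ] S k)).toNat : ℚ)
  congr e := funext fun k => by
    rw [(LinearEquiv.congrLeft (S k) R e).length_eq]
  prod {P Q} _ _ _ _ _ _ _ _ := funext fun k => by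
    have := finite_linearMap_submodule R P (S k)
    have := finite_linearMap_submodule R Q (S k)
    rw [← (LinearMap.coprodEquiv R (M := P) (M₂ := Q) (M₃ := S k) (R := Λ)).length_eq,
      Module.length_prod, ENat.toNat_add Module.length_ne_top Module.length_ne_top]
    exact Nat.cast_add _ _

theorem lengthInvariant_val_eq_zero [IsArtinianRing R] {κ N : Type u} [AddCommGroup N]
    [Module Λ N] [Module R N] [IsScalarTower R Λ N] [Module.Finite R N] (S : κ → Submodule Λ N)
    {P : Type u} [AddCommGroup P] [Module Λ P] {k : κ} (h : ∀ f : P →ₗ[Λ] S k, f = 0) :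
    (lengthInvariant R S).val P k = 0 := by
  have := subsingleton_of_forall_eq 0 h
  simp [lengthInvariant, Module.length_eq_zero]

theorem lengthInvariant_val_ne_zero [IsArtinianRing R] {κ N : Type u} [AddCommGroup N]
    [Module Λ N] [Module R N] [IsScalarTower R Λ N] [Module.Finite R N] (S : κ → Submodule Λ N)
    {P : Type u} [AddCommGroup P] [Module Λ P] [Module.Finite Λ P] {k : κ} {f : P →ₗ[Λ] S k}
    (hf : f ≠ 0) : (lengthInvariant R S).val P k ≠ 0 := by
  have := finite_linearMap_submodule R P (S k)
  have : Nontrivial (P →ₗ[Λ] S k) := ⟨f, 0, hf⟩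
  have h : (Module.length R (P →ₗ[Λ] S k)).toNat ≠ 0 := by
    rw [Ne, ENat.toNat_eq_zero, not_or]
    exact ⟨Module.length_pos.ne', Module.length_ne_top⟩
  exact Nat.cast_ne_zero.mpr h

theorem exists_ne_zero_of_finCores [IsArtinianRing R] [Module.Finite R Λ] {T : Type u}
    [AddCommGroup T] [Module Λ T] [Module.Finite Λ T] (hT : Module.Injective Λ T) {d m : ℕ}
    (hTd : PdLE Λ d T) (hΛ : FinCores Λ T m Λ) (S : Type u) [AddCommGroup S] [Module Λ S]
    [IsSimpleModule Λ S] : ∃ φ : S →ₗ[Λ] T, φ ≠ 0 := by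
  have : IsArtinianRing Λ := isArtinian_of_tower R inferInstance
  classical
  obtain ⟨κ, _, L, P, hL, hLs, hP, hPL, hPL'⟩ := exists_simple_projective_family Λ
  have := Fintype.ofFinite κ
  let v := lengthInvariant R (Λ := Λ) L
  let κ' := {k // ∃ φ : L k →ₗ[Λ] T, φ ≠ 0}
  have henv : ∀ k : κ', ∃ (E : Type u) (_ : AddCommGroup E) (_ : Module Λ E) (x : κ → ℚ),
      IsAddEnvelope Λ T (L k) E ∧ v.EulerChar d E x := fun ⟨k, φ, hφ⟩ => by
    obtain ⟨E, _, _, hE⟩ := exists_isAddEnvelope hT hφ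
    have := hE.inAdd.finite
    obtain ⟨x, hx⟩ := v.exists_eulerChar (hE.inAdd.pdLE hTd)
    exact ⟨E, _, _, x, hE, hx⟩
  choose E _ _ χ hE hχ using henv
  let U := Submodule.span ℚ (Set.range χ)
  have hU : ∀ k, v.val (P k) ∈ U.toAddSubgroup := fun k => by
    obtain ⟨π, hπ⟩ := hP k
    have : Module.Finite Λ (P k) := Module.Finite.of_surjective π
      fun x => ⟨x, LinearMap.congr_fun hπ x⟩
    have : Module.Projective Λ (P k) := Module.Projective.of_split _ π hπ
    have hv : v.EulerChar 0 (P k) (v.val (P k)) := ⟨inferInstance, inferInstance, rfl⟩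
    refine hv.mem_of_finCores hTd (fun W _ _ d' x hW hx => ?_) (e := 0) pdLE_of_projective
      (hΛ.retract hT _ π hπ)
    refine hx.mem_of_isAddEnvelope (fun S' _ _ _ ⟨φ, hφ⟩ => ?_) hTd hW
    obtain ⟨j, ⟨e⟩⟩ := hLs S'
    let j' : κ' := ⟨j, φ ∘ₗ e.toLinearMap, fun h0 => hφ (LinearMap.ext fun s => by
      simpa using LinearMap.congr_fun h0 (e.symm s))⟩
    refine ⟨E j', _, _, d, χ j', ⟨(hE j').inAdd, ?_, fun W _ _ hW ψ hψ =>
      (hE j').exists_retract W hW (ψ ∘ₗ e.toLinearMap) fun h0 => hψ (LinearMap.ext fun s => by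
        simpa using LinearMap.congr_fun h0 (e.symm s))⟩, hχ j', Submodule.subset_span ⟨j', rfl⟩⟩
    obtain ⟨s, hs⟩ := (hE j').exists_ne_zero
    exact ⟨s ∘ₗ e.symm.toLinearMap, fun h0 => hs (LinearMap.ext fun y => by
      simpa using LinearMap.congr_fun h0 (e y))⟩
  have htop : U = ⊤ := by
    rw [← top_le_iff, ← (Pi.basisFun ℚ κ).span_eq, Submodule.span_le]
    rintro _ ⟨k, rfl⟩
    have hzero : ∀ j, k ≠ j → v.val (P k) j = 0 := fun j hj =>
      lengthInvariant_val_eq_zero R L fun f => by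
        by_contra hf
        exact hj (hPL' k j f hf)
    have hne : v.val (P k) k ≠ 0 := by
      obtain ⟨f, hf⟩ := hPL k
      obtain ⟨π, hπ⟩ := hP k
      have : Module.Finite Λ (P k) := Module.Finite.of_surjective π
        fun x => ⟨x, LinearMap.congr_fun hπ x⟩
      exact lengthInvariant_val_ne_zero R L hf
    have hk : Pi.basisFun ℚ κ k = (v.val (P k) k)⁻¹ • v.val (P k) := by
      ext j
      rcases eq_or_ne k j with rfl | hj
      · simp [hne]
      · simp [hzero j hj, hj]
    rw [hk]
    exact U.smul_mem _ (hU k)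
  obtain ⟨k, ⟨e⟩⟩ := hLs S
  by_contra! hS
  have hk : ∀ φ : L k →ₗ[Λ] T, φ = 0 := fun φ => LinearMap.ext fun y => by
    simpa using LinearMap.congr_fun (hS (φ ∘ₗ e.symm.toLinearMap)) (e y)
  have hlt : Fintype.card κ' < Fintype.card κ :=
    Fintype.card_subtype_lt (x := k) fun ⟨φ, hφ⟩ => hφ (hk φ)
  have hle := finrank_range_le_card (R := ℚ) χ
  rw [Set.finrank, show Submodule.span ℚ (Set.range χ) = ⊤ from htop, finrank_top,
    Module.finrank_fintype_fun_eq_card] at hle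
  omega

end Counting

section Resolutions

variable {Λ : Type u} [Ring Λ] {I : Type u} [AddCommGroup I] [Module Λ I]

theorem ProjDimLE.pdLE {N : Type u} [AddCommGroup N] [Module Λ N] {m : ℕ}
    (h : ProjDimLE Λ N m) : PdLE Λ m N := by
  obtain ⟨P, f, g, hP, hP0, hg, hfg, hff⟩ := h
  induction m generalizing N P with
  | zero =>
    have := hP0 1 one_pos
    have hinj : Function.Injective g := by
      rw [injective_iff_map_eq_zero]
      intro x hx
      obtain ⟨y, rfl⟩ := (hfg x).1 hx
      rw [Subsingleton.elim y 0, map_zero]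
    have := hP 0
    have := Module.Projective.of_equiv (LinearEquiv.ofBijective g ⟨hinj, hg⟩)
    exact pdLE_of_projective
  | succ m ih =>
    have := hP 0
    refine (isShortExact_subtype hg).pdLE_right (ih (fun i => P (i + 1)) (fun i => f (i + 1))
      ((f 0).codRestrict _ fun x => (hfg _).2 ⟨x, rfl⟩) (fun i => hP _)
      (fun i hi => hP0 _ (by omega)) ?_ ?_ fun i => hff _) pdLE_of_projective
    · rintro ⟨x, hx⟩
      obtain ⟨y, rfl⟩ := (hfg x).1 hx
      exact ⟨y, rfl⟩
    · exact fun y => Subtype.ext_iff.trans (hff 0 y)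

theorem Function.Exact.liftQ_range {X Y Z W : Type*} [AddCommGroup X] [Module Λ X]
    [AddCommGroup Y] [Module Λ Y] [AddCommGroup Z] [Module Λ Z] [AddCommGroup W] [Module Λ W]
    {f : X →ₗ[Λ] Y} {g : Y →ₗ[Λ] Z} {k : Z →ₗ[Λ] W} (hle : LinearMap.range f ≤ LinearMap.ker g)
    (h : Function.Exact g k) : Function.Exact ((LinearMap.range f).liftQ g hle) k := by
  refine fun x => (h x).trans ⟨?_, ?_⟩
  · rintro ⟨y, rfl⟩
    exact ⟨Submodule.Quotient.mk y, rfl⟩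
  · rintro ⟨y, rfl⟩
    obtain ⟨y, rfl⟩ := Submodule.Quotient.mk_surjective _ y
    exact ⟨y, rfl⟩

theorem InjDimLE.extVanishes {N : Type u} [AddCommGroup N] [Module Λ N] {m : ℕ}
    (h : InjDimLE Λ N m) (Y : Type u) [AddCommGroup Y] [Module Λ Y] {i : ℕ} (hi : m < i) :
    ExtVanishes Λ Y N i := by
  obtain ⟨J, g, f, hJ, hJ0, hg, hfg, hff⟩ := h
  obtain ⟨i, rfl⟩ := Nat.exists_eq_succ_of_ne_zero (by omega : i ≠ 0)
  induction m generalizing N J i with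
  | zero =>
    have := hJ0 1 one_pos
    have hsurj : Function.Surjective g := fun x => (hfg x).1 (Subsingleton.elim _ _)
    exact (extVanishes_of_injective (hJ 0) hi).congr_right (LinearEquiv.ofBijective g ⟨hg, hsurj⟩)
  | succ m ih =>
    have hle : LinearMap.range g ≤ LinearMap.ker (f 0) := by
      rintro _ ⟨x, rfl⟩
      exact (hfg _).2 ⟨x, rfl⟩
    obtain ⟨i, rfl⟩ := Nat.exists_eq_succ_of_ne_zero (by omega : i ≠ 0)
    refine (isShortExact_mkQ hg).extVanishes_right₁ Y (ih (fun i => J (i + 1))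
      ((LinearMap.range g).liftQ (f 0) hle) (fun i => f (i + 1)) (fun i => hJ _)
      (fun i hi => hJ0 _ (by omega)) ?_ ?_ (fun i => hff _) i (by omega))
      (extVanishes_of_injective (hJ 0) (by omega))
    · rw [← LinearMap.ker_eq_bot, Submodule.ker_liftQ_eq_bot _ _ _ hfg.linearMap_ker_eq.le]
    · exact (hff 0).liftQ_range hle

theorem IDomdimGE.domdimGE {Y : Type u} [AddCommGroup Y] [Module Λ Y] {t : ℕ}
    (h : IDomdimGE Λ I Y t) : DomdimGE Λ I t Y := by
  obtain ⟨J, g, f, hJ, hg, hfg, hff⟩ := h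
  induction t generalizing Y J with
  | zero => trivial
  | succ t ih =>
    refine ⟨_, _, _, _, _, _, g, _, hJ 0 (by omega), isShortExact_mkQ (hg (by omega)), ?_⟩
    cases t with
    | zero => trivial
    | succ t =>
      have hfg := hfg (by omega)
      have hle : LinearMap.range g ≤ LinearMap.ker (f 0) := by
        rintro _ ⟨x, rfl⟩
        exact (hfg _).2 ⟨x, rfl⟩
      refine ih (fun i => J (i + 1)) ((LinearMap.range g).liftQ (f 0) hle) (fun i => f (i + 1))
        (fun i hi => hJ _ (by omega)) (fun _ => ?_) (fun h2 => ?_) fun i hi => hff _ (by omega)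
      · rw [← LinearMap.ker_eq_bot, Submodule.ker_liftQ_eq_bot _ _ _ hfg.linearMap_ker_eq.le]
      · exact (hff 0 (by omega)).liftQ_range hle

theorem injective_of_extVanishes {J : Type u} [AddCommGroup J] [Module Λ J]
    (h : ∀ (Y : Type u) [AddCommGroup Y] [Module Λ Y], ExtVanishes Λ Y J 1) :
    Module.Injective Λ J :=
  ⟨fun _ _ _ _ _ _ f hf φ => by
    obtain ⟨ψ, hψ⟩ := (isShortExact_mkQ hf).exists_extend (h _) φ
    exact ⟨ψ, LinearMap.congr_fun hψ⟩⟩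

/-- A module of finite projective dimension, injective dimension at most `t`, and `I`-dominant
dimension at least `t`, has a finite coresolution by injective modules of finite projective
dimension. -/
theorem DomdimGE.exists_finCores [IsNoetherianRing Λ] [Module.Finite Λ I]
    (hI : Module.Injective Λ I) {d : ℕ} (hId : PdLE Λ d I) {t e : ℕ} {Y : Type u} [AddCommGroup Y]
    [Module Λ Y] [Module.Finite Λ Y] (hYe : PdLE Λ e Y) (hY : DomdimGE Λ I t Y)
    (hYt : ∀ (N : Type u) [AddCommGroup N] [Module Λ N] (i : ℕ), t < i → ExtVanishes Λ N Y i) :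
    ∃ (J : Type u) (_ : AddCommGroup J) (_ : Module Λ J), Module.Finite Λ J ∧
      Module.Injective Λ J ∧ (∃ d', PdLE Λ d' J) ∧ FinCores Λ (I × J) t Y := by
  induction t generalizing Y e with
  | zero =>
    exact ⟨Y, _, _, inferInstance, injective_of_extVanishes fun N _ _ => hYt N 1 one_pos,
      ⟨e, hYe⟩, inAdd_self.retract (LinearMap.inr Λ I Y) (LinearMap.snd Λ I Y) (by ext; rfl)⟩
  | succ t ih =>
    obtain ⟨W, C, _, _, _, _, f, g, hW, hfg, hC⟩ := hY
    have := hW.finite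
    have := hfg.finite_right
    obtain ⟨J, _, _, hJ, hJi, hJd, hCJ⟩ := ih (hfg.pdLE_right (hYe.mono (le_max_left e d))
      ((hW.pdLE hId).mono (by omega : d ≤ max e d + 1))) hC fun N _ _ i hi =>
      hfg.extVanishes_right₃ N (extVanishes_of_injective (hW.injective hI) (by omega))
        (hYt N (i + 1) (by omega))
    exact ⟨J, _, _, hJ, hJi, hJd, W, C, _, _, _, _, f, g,
      InAdd.trans (inAdd_self.retract (LinearMap.inl Λ I J) (LinearMap.fst Λ I J) (by ext; rfl)) hW,
      hfg, hCJ⟩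

end Resolutions

section Embedding

variable {Λ : Type u} [Ring Λ] {I : Type u} [AddCommGroup I] [Module Λ I]

theorem extVanishes_of_inAdd {M Y X : Type u} [AddCommGroup M] [Module Λ M] [AddCommGroup Y]
    [Module Λ Y] [AddCommGroup X] [Module Λ X] {i : ℕ} (hi : 1 ≤ i) (h : ExtVanishes Λ Y M i)
    (hX : InAdd Λ M X) : ExtVanishes Λ Y X i :=
  hX.induction (P := fun X _ _ => ExtVanishes Λ Y X i) h
    (extVanishes_of_injective ⟨fun _ _ _ _ _ _ _ _ _ => ⟨0, fun _ => Subsingleton.elim _ _⟩⟩ hi)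
    (fun _ _ _ _ _ _ h₁ h₂ => isShortExact_inl_snd.extVanishes_right₂ Y h₁ h₂)
    (fun _ _ _ _ _ _ ι π hπ h => h.retract_right ι π hπ)

theorem extVanishes_of_pdLE [IsNoetherianRing Λ] {Y K : Type u} [AddCommGroup Y] [Module Λ Y]
    [AddCommGroup K] [Module Λ K] [Module.Finite Λ K] {d : ℕ} (hK : PdLE Λ d K)
    (hY : ∀ i, 1 ≤ i → ExtVanishes Λ Y Λ i) {i : ℕ} (hi : 1 ≤ i) : ExtVanishes Λ Y K i := by
  induction d generalizing K i with
  | zero =>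
    obtain ⟨m, p, hp⟩ := Module.Finite.exists_fin' Λ K
    have := hK.projective
    obtain ⟨s, hs⟩ := Module.projective_lifting_property p LinearMap.id hp
    exact extVanishes_of_inAdd hi (hY i hi) ⟨m, s, p, hs⟩
  | succ d ih =>
    obtain ⟨m, p, hp⟩ := Module.Finite.exists_fin' Λ K
    exact (isShortExact_subtype hp).extVanishes_right₃ Y
      (extVanishes_of_inAdd hi (hY i hi) (inAdd_pi m))
      (ih ((isShortExact_subtype hp).pdLE_left pdLE_of_projective hK) (by omega))

/-- If every simple module embeds into an injective module `T` of finite projective dimension,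
then every module `Y` with `Ext^i(Y, Λ) = 0` for `i ≥ 1` is cogenerated by `Λ`. -/
theorem exists_ne_zero_of_extVanishes [IsArtinianRing Λ] {T : Type u} [AddCommGroup T]
    [Module Λ T] [Module.Finite Λ T] (hT : Module.Injective Λ T) {d : ℕ} (hTd : PdLE Λ d T)
    (hS : ∀ (S : Type u) [AddCommGroup S] [Module Λ S] [IsSimpleModule Λ S],
      ∃ φ : S →ₗ[Λ] T, φ ≠ 0)
    {Y : Type u} [AddCommGroup Y] [Module Λ Y] [Module.Finite Λ Y]
    (hY : ∀ i, 1 ≤ i → ExtVanishes Λ Y Λ i) {y : Y} (hy : y ≠ 0) :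
    ∃ φ : Y →ₗ[Λ] Λ, φ y ≠ 0 := by
  by_contra! hall
  let N : Submodule Λ Y := ⨅ φ : Y →ₗ[Λ] Λ, LinearMap.ker φ
  have : Nontrivial N := ⟨⟨y, by simpa [N] using hall⟩, 0, fun h => hy (congrArg Subtype.val h)⟩
  obtain ⟨S, hSs⟩ := exists_isSimpleModule_submodule (Λ := Λ) N
  obtain ⟨φ, hφ⟩ := hS S
  obtain ⟨ψ, hψ⟩ := hT.out (N.subtype ∘ₗ S.subtype)
    (N.injective_subtype.comp S.injective_subtype) φ
  obtain ⟨m, p, hp⟩ := Module.Finite.exists_fin' Λ T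
  have hK := (isShortExact_subtype hp).pdLE_left (d := d) pdLE_of_projective
    (hTd.mono (Nat.le_succ d))
  obtain ⟨χ, rfl⟩ := (isShortExact_subtype hp).exists_lift (extVanishes_of_pdLE hK hY le_rfl) ψ
  refine hφ (LinearMap.ext fun s => ?_)
  have h0 : χ s.1.1 = 0 := funext fun j => by
    have := s.1.2
    simp only [N, Submodule.mem_iInf] at this
    exact this (LinearMap.proj j ∘ₗ χ)
  rw [← hψ s]
  change p (χ s.1.1) = 0
  rw [h0, map_zero]

/-- A cogenerated module `Y` with `Ext^i(Y, Λ) = 0` for `i ≥ 1` embeds into a free module with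
cokernel of the same kind. -/
theorem exists_isShortExact_pi (R : Type u) [CommRing R] [IsNoetherianRing R] [Algebra R Λ]
    [Module.Finite R Λ] {Y : Type u} [AddCommGroup Y] [Module Λ Y] [Module.Finite Λ Y]
    (hcog : ∀ y : Y, y ≠ 0 → ∃ φ : Y →ₗ[Λ] Λ, φ y ≠ 0)
    (hY : ∀ i, 1 ≤ i → ExtVanishes Λ Y Λ i) :
    ∃ (m : ℕ) (C : Type u) (_ : AddCommGroup C) (_ : Module Λ C) (f : Y →ₗ[Λ] (Fin m → Λ))
      (g : (Fin m → Λ) →ₗ[Λ] C), IsShortExact f g ∧ ∀ i, 1 ≤ i → ExtVanishes Λ C Λ i := by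
  have := finite_linearMap (Λ := Λ) R Y Λ
  obtain ⟨m, s, hs⟩ := Module.Finite.exists_fin (R := R) (M := Y →ₗ[Λ] Λ)
  have hext : ∀ φ : Y →ₗ[Λ] Λ, ∃ ψ : (Fin m → Λ) →ₗ[Λ] Λ, ψ ∘ₗ LinearMap.pi s = φ := fun φ => by
    have hφ : φ ∈ Submodule.span R (Set.range s) := hs ▸ Submodule.mem_top
    induction hφ using Submodule.span_induction with
    | mem _ h =>
      obtain ⟨j, rfl⟩ := h
      exact ⟨LinearMap.proj j, rfl⟩
    | zero => exact ⟨0, rfl⟩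
    | add _ _ _ _ h₁ h₂ =>
      obtain ⟨ψ₁, rfl⟩ := h₁
      obtain ⟨ψ₂, rfl⟩ := h₂
      exact ⟨ψ₁ + ψ₂, rfl⟩
    | smul r _ _ h =>
      obtain ⟨ψ, rfl⟩ := h
      exact ⟨r • ψ, rfl⟩
  have hinj : Function.Injective (LinearMap.pi s) := by
    rw [injective_iff_map_eq_zero]
    intro y hy
    by_contra hne
    obtain ⟨φ, hφ⟩ := hcog y hne
    obtain ⟨ψ, rfl⟩ := hext φ
    exact hφ (by rw [LinearMap.comp_apply, hy, map_zero])
  have hsh := isShortExact_mkQ hinj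
  refine ⟨m, _, _, _, _, _, hsh, fun i hi => ?_⟩
  obtain rfl | ⟨i, rfl⟩ : i = 1 ∨ ∃ j, i = j + 1 + 1 :=
    (eq_or_ne i 1).imp_right fun h => ⟨i - 2, by omega⟩
  · exact hsh.extVanishes_one_left (extVanishes_of_projective le_rfl) hext
  · exact hsh.extVanishes_left₃ Λ (hY _ (by omega)) (extVanishes_of_projective (by omega))

theorem domdimGE_of_extVanishes (R : Type u) [CommRing R] [IsNoetherianRing R] [Algebra R Λ]
    [Module.Finite R Λ] (hI : Module.Injective Λ I)
    (hcog : ∀ (Y : Type u) [AddCommGroup Y] [Module Λ Y] [Module.Finite Λ Y],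
      (∀ i, 1 ≤ i → ExtVanishes Λ Y Λ i) → ∀ y : Y, y ≠ 0 → ∃ φ : Y →ₗ[Λ] Λ, φ y ≠ 0)
    {t : ℕ} (ht : DomdimGE Λ I t Λ) {Y : Type u} [AddCommGroup Y] [Module Λ Y] [Module.Finite Λ Y]
    (hY : ∀ i, 1 ≤ i → ExtVanishes Λ Y Λ i) : DomdimGE Λ I t Y := by
  induction t generalizing Y with
  | zero => trivial
  | succ t ih =>
    obtain ⟨m, C, _, _, f, g, hfg, hC⟩ := exists_isShortExact_pi R (hcog Y hY) hY
    have := hfg.finite_right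
    exact DomdimGE.left hI hfg (ht.pi hI m) (ih (ht.mono (Nat.le_succ t)) hC)

/-- The dual `Hom_A(-, I)`, `A = End_Λ(I)`, takes `add A` to `add I`. -/
theorem InAdd.dual_end {W : Type u} [AddCommGroup W] [Module (Module.End Λ I) W]
    (hW : InAdd (Module.End Λ I) (Module.End Λ I) W) :
    InAdd Λ I (W →ₗ[Module.End Λ I] I) := by
  refine hW.induction (P := fun W _ _ => InAdd Λ I (W →ₗ[Module.End Λ I] I)) ?_ ?_ ?_ ?_
  · exact inAdd_self.congr (LinearMap.ringLmapEquivSelf (Module.End Λ I) Λ I)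
  · have : Subsingleton (PUnit.{u + 1} →ₗ[Module.End Λ I] I) := ⟨fun f g => by
      ext x
      rw [Subsingleton.elim x 0, map_zero, map_zero]⟩
    exact ⟨0, 0, 0, LinearMap.ext fun _ => Subsingleton.elim _ _⟩
  · intro X Y _ _ _ _ hX hY
    exact (hX.prod hY).congr (LinearMap.coprodEquiv (R := Module.End Λ I) (M := X) (M₂ := Y)
      (M₃ := I) Λ).symm
  · intro X Y _ _ _ _ ι π h hY
    refine hY.retract (LinearMap.lcomp Λ I π) (LinearMap.lcomp Λ I ι) ?_
    ext f x
    exact congrArg f (LinearMap.congr_fun h x)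

/-- The dual of a finitely generated `End_Λ(I)`-module is a second syzygy of modules in
`add I`. -/
theorem exists_isShortExact_dual [IsNoetherianRing (Module.End Λ I)] (X : Type u)
    [AddCommGroup X] [Module (Module.End Λ I) X] [Module.Finite (Module.End Λ I) X] :
    ∃ (V C W D : Type u) (_ : AddCommGroup V) (_ : Module Λ V) (_ : AddCommGroup C)
      (_ : Module Λ C) (_ : AddCommGroup W) (_ : Module Λ W) (_ : AddCommGroup D)
      (_ : Module Λ D) (f : (X →ₗ[Module.End Λ I] I) →ₗ[Λ] V) (g : V →ₗ[Λ] C) (f' : C →ₗ[Λ] W)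
      (g' : W →ₗ[Λ] D), InAdd Λ I V ∧ InAdd Λ I W ∧ IsShortExact f g ∧ IsShortExact f' g' := by
  obtain ⟨a, p, hp⟩ := Module.Finite.exists_fin' (Module.End Λ I) X
  obtain ⟨b, q, hq⟩ := Module.Finite.exists_fin' (Module.End Λ I) (LinearMap.ker p)
  let F := LinearMap.lcomp Λ I ((LinearMap.ker p).subtype ∘ₗ q)
  refine ⟨_, LinearMap.range F, _, _, inferInstance, inferInstance, inferInstance, inferInstance,
    inferInstance, inferInstance, inferInstance, inferInstance, LinearMap.lcomp Λ I p,
    F.rangeRestrict, (LinearMap.range F).subtype, _, (inAdd_pi a).dual_end, (inAdd_pi b).dual_end,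
    ⟨fun φ ψ h => ?_, fun φ => ?_, F.surjective_rangeRestrict⟩,
    isShortExact_mkQ (Submodule.injective_subtype _)⟩
  · ext x
    obtain ⟨y, rfl⟩ := hp x
    exact LinearMap.congr_fun h y
  · rw [Subtype.ext_iff]
    constructor
    · intro h
      refine (isShortExact_subtype hp).exists_desc φ (LinearMap.ext fun z => ?_)
      obtain ⟨y, rfl⟩ := hq z
      exact LinearMap.congr_fun h y
    · rintro ⟨ψ, rfl⟩
      refine LinearMap.ext fun y => ?_
      change ψ (p (q y).1) = 0
      rw [LinearMap.mem_ker.mp (q y).2, map_zero]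

end Embedding

section Duality

variable {Λ : Type u} [Ring Λ] {I : Type u} [AddCommGroup I] [Module Λ I]

theorem isNoetherianRing_end (R : Type u) [CommRing R] [IsNoetherianRing R] [Algebra R Λ]
    [Module.Finite R Λ] [Module.Finite Λ I] : IsNoetherianRing (Module.End Λ I) := by
  let := Module.compHom I (algebraMap R Λ)
  have : IsScalarTower R Λ I := IsScalarTower.of_algebraMap_smul fun _ _ => rfl
  have := Module.Finite.trans (R := R) Λ I
  have := finite_linearMap (Λ := Λ) R I I
  exact isNoetherian_of_tower R (inferInstance : IsNoetherian R (Module.End Λ I))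

/-- If `Λ` has injective dimension at most its `I`-dominant dimension, then every module `Y` with
`Ext^i(Y, Λ) = 0` for `i ≥ 1` is cogenerated by `Λ`. -/
theorem DomdimGE.exists_ne_zero (R : Type u) [CommRing R] [IsArtinianRing R] [Algebra R Λ]
    [Module.Finite R Λ] [Module.Finite Λ I] (hI : Module.Injective Λ I) {d t : ℕ}
    (hId : PdLE Λ d I) (hΛ : DomdimGE Λ I t Λ)
    (hid : ∀ (N : Type u) [AddCommGroup N] [Module Λ N] (i : ℕ), t < i → ExtVanishes Λ N Λ i)
    {Y : Type u} [AddCommGroup Y] [Module Λ Y] [Module.Finite Λ Y]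
    (hY : ∀ i, 1 ≤ i → ExtVanishes Λ Y Λ i) {y : Y} (hy : y ≠ 0) :
    ∃ φ : Y →ₗ[Λ] Λ, φ y ≠ 0 := by
  have : IsArtinianRing Λ := isArtinian_of_tower R inferInstance
  obtain ⟨J, _, _, _, hJ, ⟨d', hJd⟩, hcores⟩ :=
    hΛ.exists_finCores hI hId (pdLE_of_projective (d := 0)) hid
  have hT : Module.Injective Λ (I × J) := injective_of_extVanishes fun N _ _ =>
    isShortExact_inl_snd.extVanishes_right₂ N (extVanishes_of_injective hI le_rfl)
      (extVanishes_of_injective hJ le_rfl)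
  have hTd : PdLE Λ (max d d') (I × J) := isShortExact_inl_snd.pdLE_middle
    (hId.mono (le_max_left _ _)) (hJd.mono (le_max_right _ _))
  exact exists_ne_zero_of_extVanishes hT hTd
    (fun S _ _ _ => exists_ne_zero_of_finCores R hT hTd hcores S) hY hy

theorem extVanishes_dual_of_pdLE [IsNoetherianRing (Module.End Λ I)] (hId : PdLE Λ 1 I)
    {X : Type u} [AddCommGroup X] [Module (Module.End Λ I) X]
    [Module.Finite (Module.End Λ I) X] {t i : ℕ}
    (hid : ∀ (N : Type u) [AddCommGroup N] [Module Λ N] (i : ℕ), t < i → ExtVanishes Λ N Λ i)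
    (hi : 2 ≤ i) (ht : t < i + 2) : ExtVanishes Λ (X →ₗ[Module.End Λ I] I) Λ i := by
  obtain ⟨V, C, W, D, _, _, _, _, _, _, _, _, f, g, f', g', hV, hW, h, h'⟩ :=
    exists_isShortExact_dual (Λ := Λ) (I := I) X
  exact h.extVanishes_left₁ Λ (hV.pdLE hId i hi Λ)
    (h'.extVanishes_left₁ Λ (hW.pdLE hId (i + 1) (by omega) Λ) (hid D _ ht))

theorem finite_dual [IsNoetherianRing Λ] [IsNoetherianRing (Module.End Λ I)] [Module.Finite Λ I]
    (X : Type u) [AddCommGroup X] [Module (Module.End Λ I) X] [Module.Finite (Module.End Λ I) X] :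
    Module.Finite Λ (X →ₗ[Module.End Λ I] I) := by
  obtain ⟨V, C, W, D, _, _, _, _, _, _, _, _, f, g, f', g', hV, hW, h, h'⟩ :=
    exists_isShortExact_dual (Λ := Λ) (I := I) X
  have := hV.finite
  exact h.finite_left

end Duality

/-- Let `Λ` be an almost `n`-minimal Auslander-Gorenstein algebra (`n ≥ 2`),
`A = End_Λ(I)` and `M = I` viewed as an `A`-module. Then for every finitely generated
`A`-module `X`: if `Ext^i_A(M,X) = 0` for `1 ≤ i ≤ n-1`, then `Ext^i_A(X,M) = 0` for
`1 ≤ i ≤ n-1`. -/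
theorem stmt13 (R : Type u) [CommRing R] [IsArtinianRing R]
    (Λ : Type u) [Ring Λ] [Algebra R Λ] [Module.Finite R Λ]
    (n : ℕ) (hn : 2 ≤ n)
    (I : Type u) [AddCommGroup I] [Module Λ I] [Module.Finite Λ I]
    (hIinj : Module.Injective Λ I) (hIpd : ProjDimLE Λ I 1)
    (haddI : ∀ (J : Type u) [AddCommGroup J] [Module Λ J], Module.Finite Λ J →
      ((Module.Injective Λ J ∧ ProjDimLE Λ J 1) ↔ InAdd Λ I J))
    (hid : InjDimLE Λ Λ (n + 1))
    (hdom : IDomdimGE Λ I Λ (n + 1)) :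
    ∀ (X : Type u) [AddCommGroup X] [Module (Module.End Λ I) X],
      Module.Finite (Module.End Λ I) X →
      (∀ i : ℕ, 1 ≤ i → i ≤ n - 1 → ExtVanishes (Module.End Λ I) I X i) →
      (∀ i : ℕ, 1 ≤ i → i ≤ n - 1 → ExtVanishes (Module.End Λ I) X I i) := by
  intro X _ _ _ hX
  have : IsArtinianRing Λ := isArtinian_of_tower R inferInstance
  have : IsNoetherianRing (Module.End Λ I) := isNoetherianRing_end R
  have hΛ := hdom.domdimGE
  have hext (N : Type u) [AddCommGroup N] [Module Λ N] (i : ℕ) (hi : n + 1 < i) :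
    ExtVanishes Λ N Λ i := hid.extVanishes N hi
  have := finite_dual (Λ := Λ) (I := I) X
  let eX := LinearEquiv.ofBijective _ (biEval_end_bijective hIinj X)
  let eI := LinearMap.ringLmapEquivSelf Λ (Module.End Λ I) I
  have hY : ∀ i, 1 ≤ i → ExtVanishes Λ (X →ₗ[Module.End Λ I] I) Λ i := fun i hi => by
    by_cases hin : i ≤ n - 1
    · exact (DomdimGE.extVanishes_dual_iff hIinj hi (hΛ.mono (by omega))).1
        (((hX i hi hin).congr_left eI).congr_right eX.symm)
    · exact extVanishes_dual_of_pdLE hIpd.pdLE hext (by omega) (by omega)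
  have hdomY := domdimGE_of_extVanishes R hIinj
    (fun Y _ _ _ hY _ => hΛ.exists_ne_zero R hIinj hIpd.pdLE hext hY) hΛ hY
  intro i hi hin
  exact (((DomdimGE.extVanishes_dual_iff hIinj hi (hdomY.mono (by omega))).2
    (extVanishes_of_projective hi)).congr_left eX).congr_right eI.symm
end

section
/- Let A be an Artin algebra, n ≥ 3, and M a finitely generated A-module such that M is a cogenerator over A, Ext^i_A(M,M) = 0 for 1 ≤ i ≤ n−1, and there exists an exact sequence 0 → A → M_0 → M_1 → 0 of A-modules with M_0, M_1 ∈ add M. Then Ext^i_A(M,A) = 0 for all 2 ≤ i ≤ n−1. -/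
open CategoryTheory

universe u

lemma subsingleton_ext_of_inAdd {A : Type u} [Ring A] {N M X : ModuleCat.{u} A} {i : ℕ}
    (hX : InAdd A M X) [Subsingleton (Abelian.Ext N M i)] :
    Subsingleton (Abelian.Ext N X i) := by
  obtain ⟨k, ι, π, h⟩ := hX
  have hid : 𝟙 X = ∑ j : Fin k, ModuleCat.ofHom (LinearMap.proj j ∘ₗ ι) ≫
      ModuleCat.ofHom (π ∘ₗ LinearMap.single A (fun _ ↦ (M : Type u)) j) := by
    ext x
    have hx := LinearMap.congr_fun h x
    simp only [LinearMap.comp_apply, LinearMap.id_apply] at hx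
    simp [ModuleCat.hom_sum, ← map_sum, Finset.univ_sum_single, hx]
  refine subsingleton_of_forall_eq 0 fun (x : Abelian.Ext N X i) ↦ ?_
  rw [← x.comp_mk₀_id, hid, Abelian.Ext.mk₀_sum, Abelian.Ext.comp_sum]
  refine Finset.sum_eq_zero fun j _ ↦ ?_
  rw [← Abelian.Ext.mk₀_comp_mk₀,
    ← Abelian.Ext.comp_assoc_of_second_deg_zero,
    Subsingleton.elim (x.comp (Abelian.Ext.mk₀ _) _) 0, Abelian.Ext.zero_comp]

/-- Let `A` be an Artin algebra, `n ≥ 3`, and `M` a finitely generated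
cogenerator with `Ext^i_A(M,M) = 0` for `1 ≤ i ≤ n-1` admitting an exact sequence
`0 → A → M_0 → M_1 → 0` with `M_0, M_1 ∈ add M`. Then `Ext^i_A(M,A) = 0` for
`2 ≤ i ≤ n-1`. -/
theorem stmt14 (R : Type u) [CommRing R] [IsArtinianRing R]
    (A : Type u) [Ring A] [Algebra R A] [Module.Finite R A]
    (n : ℕ) (hn : 3 ≤ n)
    (M : Type u) [AddCommGroup M] [Module A M] [Module.Finite A M]
    (hcog : IsCogenerator A M)
    (hext : ∀ i : ℕ, 1 ≤ i → i ≤ n - 1 → ExtVanishes A M M i)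
    (hres : ∃ (M₀ M₁ : ModuleCat.{u} A) (g : A →ₗ[A] M₀) (f : (M₀ : Type u) →ₗ[A] M₁),
      InAdd A M M₀ ∧ InAdd A M M₁ ∧
      Function.Injective g ∧ Function.Surjective f ∧ Function.Exact g f) :
    ∀ i : ℕ, 2 ≤ i → i ≤ n - 1 → ExtVanishes A M A i := by
  obtain ⟨M₀, M₁, g, f, hM₀, hM₁, hg, hf, hgf⟩ := hres
  intro i hi hin
  let S : ShortComplex (ModuleCat.{u} A) :=
    ShortComplex.mk (ModuleCat.ofHom g) (ModuleCat.ofHom f)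
      (ModuleCat.hom_ext (LinearMap.ext hgf.apply_apply_eq_zero))
  have hS : S.ShortExact :=
    { exact := (ShortComplex.ShortExact.moduleCat_exact_iff_function_exact S).2 hgf
      mono_f := (ModuleCat.mono_iff_injective _).2 hg
      epi_g := (ModuleCat.epi_iff_surjective _).2 hf }
  obtain ⟨m, rfl⟩ : ∃ m, i = m + 1 := ⟨i - 1, by omega⟩
  have : Subsingleton (Abelian.Ext (ModuleCat.of A M) (ModuleCat.of A M) (m + 1)) :=
    hext _ (by omega) hin
  have : Subsingleton (Abelian.Ext (ModuleCat.of A M) (ModuleCat.of A M) m) :=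
    hext _ (by omega) (by omega)
  have : Subsingleton (Abelian.Ext (ModuleCat.of A M) S.X₂ (m + 1)) :=
    subsingleton_ext_of_inAdd (M := ModuleCat.of A M) hM₀
  have : Subsingleton (Abelian.Ext (ModuleCat.of A M) S.X₃ m) :=
    subsingleton_ext_of_inAdd (M := ModuleCat.of A M) hM₁
  refine subsingleton_of_forall_eq 0 fun x ↦ ?_
  obtain ⟨y, rfl⟩ := Abelian.Ext.covariant_sequence_exact₁ (ModuleCat.of A M) hS x
    (Subsingleton.elim _ _) rfl
  rw [Subsingleton.elim y 0, Abelian.Ext.zero_comp]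
end
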